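/- arXiv:2508.14333 — 2 statements merged into one kernel-verified Lean document; each statement's English description precedes it below -/
import Mathlib

section
/- There exists a constant C > 0, depending only on C_H and d, such that for every δ > 0, x ∈ 𝕋^d, p, p' ∈ ℝ^d, μ ∈ P(𝕋^d), if v and v' are classical (C²) solutions of the discounted cell problem δw(y) − tr(a D²w(y)) + H(x, y, r, Dw(y), μ) = 0 on 𝕋^d with parameter r = p and r = p' respectively, then sup_{y∈𝕋^d} |v(y) − v'(y)| ≤ (C/δ)(1 + |p| + |p'|) |p − p'|. -/
noncomputable section

open MeasureTheory Metric Filter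
open scoped RealInnerProductSpace ENNReal Topology

instance : Fact ((0:ℝ) < 1) := ⟨one_pos⟩

/-- Euclidean space `ℝ^d`. -/
abbrev Euc (d : ℕ) := EuclideanSpace ℝ (Fin d)

/-- The flat torus `𝕋^d = ℝ^d/ℤ^d`, realized as a product of circles. -/
abbrev Torus (d : ℕ) := Fin d → AddCircle (1 : ℝ)

/-- Canonical projection `ℝ^d → 𝕋^d`. -/
def Torus.proj {d : ℕ} (y : Euc d) : Torus d := fun i => (y i : AddCircle (1 : ℝ))

/-- The 1-Wasserstein distance between two (probability) measures on a metric
measurable space: the infimum over all couplings of the expected distance. -/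
def W1 {X : Type*} [MeasurableSpace X] [PseudoMetricSpace X] (μ ν : Measure X) : ℝ :=
  ⨅ π : {π : Measure (X × X) //
      IsProbabilityMeasure π ∧ π.map Prod.fst = μ ∧ π.map Prod.snd = ν},
    ∫ z, dist z.1 z.2 ∂(π : Measure (X × X))

/-- `P(𝕋^d)`: Borel probability measures on the torus. -/
abbrev ProbT (d : ℕ) := ProbabilityMeasure (Torus d)

/-- 1-Wasserstein distance on `P(𝕋^d)`. -/
def W1T {d : ℕ} (μ ν : ProbT d) : ℝ := W1 (μ : Measure (Torus d)) (ν : Measure (Torus d))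

/-- Second partial derivative `∂²v/∂yᵢ∂yⱼ`. -/
def hess {d : ℕ} (v : Euc d → ℝ) (y : Euc d) (i j : Fin d) : ℝ :=
  iteratedFDeriv ℝ 2 v y ![EuclideanSpace.single i 1, EuclideanSpace.single j 1]

/-- `tr(a D²v)(y)` for a constant matrix `a`. -/
def trAH {d : ℕ} (a : Matrix (Fin d) (Fin d) ℝ) (v : Euc d → ℝ) (y : Euc d) : ℝ :=
  ∑ i, ∑ j, a i j * hess v y j i

/-- The `ℤ^d`-periodic lift of a function on the torus. -/
def tlift {d : ℕ} (v : Torus d → ℝ) : Euc d → ℝ := fun y => v (Torus.proj y)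

/-- `v : 𝕋^d → ℝ` is a classical (C²) solution of the discounted cell problem
`δ v(y) - tr(a D²v(y)) + H(x, y, p, Dv(y), μ) = 0` on `𝕋^d`. -/
def IsSol {d : ℕ} (a : Matrix (Fin d) (Fin d) ℝ)
    (H : Torus d → Torus d → Euc d → Euc d → ProbT d → ℝ)
    (δ : ℝ) (x : Torus d) (p : Euc d) (μ : ProbT d) (v : Torus d → ℝ) : Prop :=
  ContDiff ℝ 2 (tlift v) ∧
  ∀ y : Euc d,
    δ * v (Torus.proj y) - trAH a (tlift v) y
      + H x (Torus.proj y) p (gradient (tlift v) y) μ = 0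

/-- The canonical projection `ℝ^d → 𝕋^d` is already surjective on the unit cube. -/
theorem Torus.exists_proj_eq {d : ℕ} (x : Torus d) :
    ∃ y : Euc d, (∀ i, y i ∈ Set.Icc (0 : ℝ) 1) ∧ Torus.proj y = x := by
  have h : ∀ i, ∃ t : ℝ, t ∈ Set.Icc (0 : ℝ) 1 ∧ (t : AddCircle (1 : ℝ)) = x i := fun i =>
    ⟨AddCircle.equivIco 1 0 (x i),
      ⟨(AddCircle.equivIco 1 0 (x i)).2.1,
        by simpa using (AddCircle.equivIco 1 0 (x i)).2.2.le⟩,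
      (AddCircle.equivIco 1 0).symm_apply_apply (x i)⟩
  choose t ht hx using h
  exact ⟨WithLp.toLp 2 t, ht, funext hx⟩

/-- A function on the torus with continuous lift attains its maximum. -/
theorem exists_forall_tlift_le {d : ℕ} {w : Torus d → ℝ} (hw : Continuous (tlift w)) :
    ∃ y₀ : Euc d, ∀ x, w x ≤ tlift w y₀ := by
  have hK : IsCompact ((WithLp.toLp 2 : (Fin d → ℝ) → Euc d) ''
      Set.pi Set.univ fun _ => Set.Icc (0 : ℝ) 1) :=
    (isCompact_univ_pi fun _ => isCompact_Icc).image (PiLp.continuous_toLp 2 _)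
  obtain ⟨y₀, -, hy₀⟩ := hK.exists_isMaxOn
    ⟨_, 0, fun _ _ => ⟨le_rfl, zero_le_one⟩, rfl⟩ hw.continuousOn
  refine ⟨y₀, fun x => ?_⟩
  obtain ⟨y, hy, rfl⟩ := Torus.exists_proj_eq x
  exact hy₀ ⟨y.ofLp, fun i _ => hy i, rfl⟩

/-- Second order necessary condition for a local maximum on the line. -/
theorem IsLocalMax.deriv_deriv_nonpos {φ : ℝ → ℝ} {t : ℝ} (h : IsLocalMax φ t)
    (hc : ContinuousAt φ t) : deriv (deriv φ) t ≤ 0 := by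
  by_contra! hpos
  have hmin := isLocalMin_of_deriv_deriv_pos hpos h.deriv_eq_zero hc
  have hconst : φ =ᶠ[𝓝 t] fun _ => φ t := by
    filter_upwards [h, hmin] with s h₁ h₂ using le_antisymm h₁ h₂
  have := hconst.deriv.deriv_eq
  simp at this
  linarith

/-- Second order necessary condition for a local maximum. -/
theorem IsLocalMax.iteratedFDeriv_two_nonpos {E : Type*} [NormedAddCommGroup E]
    [NormedSpace ℝ E] {w : E → ℝ} {y : E} (h : IsLocalMax w y) (hw : ContDiff ℝ 2 w) (u : E) :
    iteratedFDeriv ℝ 2 w y ![u, u] ≤ 0 := by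
  have hline : ∀ t : ℝ, HasDerivAt (fun s : ℝ => y + s • u) u t := fun t => by
    simpa using ((hasDerivAt_id t).smul_const u).const_add y
  have hd : deriv (fun t : ℝ => w (y + t • u)) = fun t : ℝ => fderiv ℝ w (y + t • u) u := by
    funext t
    exact (((hw.differentiable (by norm_num)) _).hasFDerivAt.comp_hasDerivAt t (hline t)).deriv
  have hd2 : deriv (deriv fun t : ℝ => w (y + t • u)) 0 = fderiv ℝ (fderiv ℝ w) y u u := by
    rw [hd]
    have hw' : Differentiable ℝ (fderiv ℝ w) :=
      (hw.fderiv_right (m := 1) (by norm_num)).differentiable (by norm_num)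
    have := (((hw' _).hasFDerivAt.comp_hasDerivAt (0 : ℝ) (hline 0)).clm_apply
      (hasDerivAt_const (0 : ℝ) u)).deriv
    simpa using this
  have hcont : Continuous fun t : ℝ => y + t • u := by fun_prop
  have hmax : IsLocalMax (fun t : ℝ => w (y + t • u)) 0 := by
    have ht : Tendsto (fun t : ℝ => y + t • u) (𝓝 0) (𝓝 y) := by
      simpa using hcont.tendsto 0
    have := ht.eventually h
    simpa [IsLocalMax, IsMaxFilter] using this
  rw [iteratedFDeriv_two_apply]
  simpa [hd2] using hmax.deriv_deriv_nonpos (hw.continuous.comp hcont).continuousAt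

/-- If `a` is positive semidefinite, then `tr(a D²w) ≤ 0` at a local maximum of `w`. -/
theorem trAH_nonpos_of_isLocalMax {d : ℕ} {a : Matrix (Fin d) (Fin d) ℝ} (ha : a.PosSemidef)
    {w : Euc d → ℝ} {y : Euc d} (h : IsLocalMax w y) (hw : ContDiff ℝ 2 w) :
    trAH a w y ≤ 0 := by
  obtain ⟨m, s, rfl⟩ := Matrix.posSemidef_iff_eq_sum_vecMulVec.mp ha
  have key : trAH (∑ k, Matrix.vecMulVec (s k) (star (s k))) w y =
      ∑ k, iteratedFDeriv ℝ 2 w y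
        ![∑ j, s k j • EuclideanSpace.single j 1, ∑ i, s k i • EuclideanSpace.single i 1] := by
    simp only [trAH, hess, iteratedFDeriv_two_apply, Matrix.cons_val_zero, Matrix.cons_val_one,
      map_sum, map_smul, _root_.sum_apply, _root_.smul_apply,
      smul_eq_mul, Matrix.sum_apply, Matrix.vecMulVec_apply, star_trivial,
      Finset.sum_mul, Finset.mul_sum]
    rw [Finset.sum_congr rfl fun i _ => Finset.sum_comm, Finset.sum_comm]
    refine Finset.sum_congr rfl fun k _ => Finset.sum_congr rfl fun i _ =>
      Finset.sum_congr rfl fun j _ => ?_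
    ring
  rw [key]
  exact Finset.sum_nonpos fun k _ => h.iteratedFDeriv_two_nonpos hw _

theorem trAH_sub {d : ℕ} (a : Matrix (Fin d) (Fin d) ℝ) {v v' : Euc d → ℝ}
    (hv : ContDiff ℝ 2 v) (hv' : ContDiff ℝ 2 v') (y : Euc d) :
    trAH a (v - v') y = trAH a v y - trAH a v' y := by
  simp only [trAH, hess, iteratedFDeriv_sub hv hv', Pi.sub_apply,
    _root_.sub_apply, mul_sub, Finset.sum_sub_distrib]

/-- One-sided comparison for solutions of the discounted cell problem, by the maximum
principle. -/
theorem IsSol.sub_le {d : ℕ} {a : Matrix (Fin d) (Fin d) ℝ} (ha : a.PosSemidef)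
    {H : Torus d → Torus d → Euc d → Euc d → ProbT d → ℝ} {δ : ℝ} (hδ : 0 < δ)
    {x : Torus d} {p p' : Euc d} {μ : ProbT d} {v v' : Torus d → ℝ}
    (hv : IsSol a H δ x p μ v) (hv' : IsSol a H δ x p' μ v') {B : ℝ}
    (hB : ∀ y q, H x y p' q μ - H x y p q μ ≤ B) (y : Torus d) :
    v y - v' y ≤ B / δ := by
  obtain ⟨hC, hE⟩ := hv
  obtain ⟨hC', hE'⟩ := hv'
  have hw : ContDiff ℝ 2 (tlift v - tlift v') := hC.sub hC'
  obtain ⟨y₀, hy₀⟩ := exists_forall_tlift_le (w := v - v') hw.continuous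
  have hmax : IsLocalMax (tlift v - tlift v') y₀ := Eventually.of_forall fun z => hy₀ _
  have htr := trAH_nonpos_of_isLocalMax ha hmax hw
  rw [trAH_sub a hC hC'] at htr
  have hgrad : gradient (tlift v) y₀ = gradient (tlift v') y₀ := by
    have h0 := hmax.fderiv_eq_zero
    rw [fderiv_sub (hC.differentiable (by norm_num) _) (hC'.differentiable (by norm_num) _),
      sub_eq_zero] at h0
    rw [gradient, gradient, h0]
  have h₁ := hE y₀
  have h₂ := hE' y₀
  rw [hgrad] at h₁
  have h₃ := hB (Torus.proj y₀) (gradient (tlift v') y₀)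
  have h₄ : v y - v' y ≤ v (Torus.proj y₀) - v' (Torus.proj y₀) := hy₀ y
  refine h₄.trans ((le_div_iff₀ hδ).mpr ?_)
  linarith

/-- There is a constant `C > 0`, depending only on `C_H` and `d`, such that for
any two classical solutions `v, v'` of the discounted cell problem with momentum parameters `p`
and `p'` (and the same `δ, x, μ`), `sup_y |v(y) − v'(y)| ≤ (C/δ)(1 + |p| + |p'|) |p − p'|`. -/
theorem discounted_solutions_p_stability (d : ℕ) (C_H : ℝ) :
    ∃ C : ℝ, 0 < C ∧
      ∀
    -- `a = σ₂σ₂ᵀ + σ_{0,2}σ_{0,2}ᵀ` is a constant symmetric positive definite matrix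
    (a : Matrix (Fin d) (Fin d) ℝ) (ha : a.PosDef) (haS : a.IsSymm)
    -- `A ⊂ ℝ^{2d}` is a compact set of controls
    (A : Set (Euc (2*d))) (hA : IsCompact A)
    -- the data `c, f, L`, continuous and Lipschitz in `(x,y,μ)` uniformly in `α ∈ A`
    (c f : Torus d → Torus d → Euc (2*d) → ProbT d → Euc d)
    (L : Torus d → Torus d → Euc (2*d) → ProbT d → ℝ)
    (hccont : ∀ μ, Continuous fun z : Torus d × Torus d × Euc (2*d) => c z.1 z.2.1 z.2.2 μ)
    (hfcont : ∀ μ, Continuous fun z : Torus d × Torus d × Euc (2*d) => f z.1 z.2.1 z.2.2 μ)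
    (hLcont : ∀ μ, Continuous fun z : Torus d × Torus d × Euc (2*d) => L z.1 z.2.1 z.2.2 μ)
    (K : ℝ)
    (hclip : ∀ x x' y y' α μ μ', α ∈ A →
      ‖c x y α μ - c x' y' α μ'‖ ≤ K * (dist x x' + dist y y' + W1T μ μ'))
    (hflip : ∀ x x' y y' α μ μ', α ∈ A →
      ‖f x y α μ - f x' y' α μ'‖ ≤ K * (dist x x' + dist y y' + W1T μ μ'))
    (hLlip : ∀ x x' y y' α μ μ', α ∈ A →
      |L x y α μ - L x' y' α μ'| ≤ K * (dist x x' + dist y y' + W1T μ μ'))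
    -- the Bellman Hamiltonian
    (H : Torus d → Torus d → Euc d → Euc d → ProbT d → ℝ)
    (hHdef : ∀ x y p q μ,
      H x y p q μ =
        sSup ((fun α => -⟪p, c x y α μ⟫ - ⟪q, f x y α μ⟫ - L x y α μ) '' A))
    (β : ℝ) (hβ0 : 0 < β) (hβ1 : β < 1)
    (hHC2 : ∀ μ, ContDiff ℝ 2
      (fun z : Euc d × Euc d × Euc d × Euc d =>
        H (Torus.proj z.1) (Torus.proj z.2.1) z.2.2.1 z.2.2.2 μ))
    -- with second derivative locally β-Hölder continuous uniformly in `μ`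
    (hHholder : ∀ R : ℝ, 0 < R → ∃ C : ℝ, ∀ μ, ∀ z z' : Euc d × Euc d × Euc d × Euc d,
      ‖z‖ ≤ R → ‖z'‖ ≤ R →
      ‖iteratedFDeriv ℝ 2 (fun w : Euc d × Euc d × Euc d × Euc d =>
          H (Torus.proj w.1) (Torus.proj w.2.1) w.2.2.1 w.2.2.2 μ) z
        - iteratedFDeriv ℝ 2 (fun w : Euc d × Euc d × Euc d × Euc d =>
          H (Torus.proj w.1) (Torus.proj w.2.1) w.2.2.1 w.2.2.2 μ) z'‖
        ≤ C * ‖z - z'‖ ^ β)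
    -- `|D_x H| ≤ C_H (1+|p|)` and `|D_p H| ≤ C_H (1+|p|)`
    (hDx : ∀ (x : Euc d) (y : Torus d) (p q : Euc d) (μ : ProbT d),
      ‖fderiv ℝ (fun x' : Euc d => H (Torus.proj x') y p q μ) x‖ ≤ C_H * (1 + ‖p‖))
    (hDp : ∀ (x y : Torus d) (p q : Euc d) (μ : ProbT d),
      ‖fderiv ℝ (fun p' : Euc d => H x y p' q μ) p‖ ≤ C_H * (1 + ‖p‖))
      (δ : ℝ), 0 < δ →
      ∀ (x : Torus d) (p p' : Euc d) (μ : ProbT d) (v v' : Torus d → ℝ),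
        IsSol a H δ x p μ v → IsSol a H δ x p' μ v' →
          (⨆ y : Torus d, |v y - v' y|) ≤ (C / δ) * (1 + ‖p‖ + ‖p'‖) * ‖p - p'‖ := by
  refine ⟨|C_H| + 1, by positivity, ?_⟩
  intro a ha _ A _ c f L _ _ _ K _ _ _ H _ β _ _ hHC2 _ _ hDp δ hδ x p p' μ v v' hv hv'
  have hdiff : ∀ y q, Differentiable ℝ fun r : Euc d => H x y r q μ := by
    intro y q
    obtain ⟨x₀, -, rfl⟩ := Torus.exists_proj_eq x
    obtain ⟨y₀, -, rfl⟩ := Torus.exists_proj_eq y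
    exact ((hHC2 μ).differentiable (by norm_num)).comp
      (show Differentiable ℝ fun r : Euc d => (x₀, y₀, r, q) by fun_prop)
  have hB : ∀ y q, |H x y p q μ - H x y p' q μ| ≤
      (|C_H| + 1) * (1 + ‖p‖ + ‖p'‖) * ‖p - p'‖ := by
    intro y q
    refine (convex_closedBall (0 : Euc d) (‖p‖ + ‖p'‖)).norm_image_sub_le_of_norm_fderiv_le
      (𝕜 := ℝ) (f := fun r : Euc d => H x y r q μ) (fun r _ => hdiff y q r)
      (fun r hr => (hDp x y r q μ).trans ?_) (by simp) (by simp)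
    rw [mem_closedBall_zero_iff] at hr
    exact mul_le_mul ((le_abs_self _).trans (by linarith)) (by linarith) (by positivity)
      (by positivity)
  refine ciSup_le fun y => ?_
  rw [div_mul_eq_mul_div, div_mul_eq_mul_div, abs_le]
  have h₁ := hv.sub_le ha.posSemidef hδ hv' (fun y q => (abs_le'.mp (hB y q)).2.trans' (by simp)) y
  have h₂ := hv'.sub_le ha.posSemidef hδ hv (fun y q => (abs_le.mp (hB y q)).2) y
  constructor <;> linarith
end
end

section
/- Fix δ > 0 and μ ∈ P(𝕋^d), and for each (x,p) ∈ 𝕋^d × ℝ^d let v^δ(x,p,·) be the unique classical (C²) solution of δv(y) − tr(a D²v(y)) + H(x, y, p, Dv(y), μ) = 0 on 𝕋^d. Then the map (x,p) ↦ v^δ(x,p,y) is twice continuously differentiable: the second derivatives D²_{xx}v^δ, D²_{pp}v^δ, D²_{xp}v^δ and D²_{px}v^δ exist and are continuous functions of (x,p,y). -/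
noncomputable section

open MeasureTheory Metric Filter
open scoped RealInnerProductSpace ENNReal Topology

section SecondOrder

lemma second_deriv_nonpos_of_isLocalMax {k k' : ℝ → ℝ} {c : ℝ}
    (h1 : ∀ s, HasDerivAt k (k' s) s) (h2 : HasDerivAt k' c 0) (hm : IsLocalMax k 0) :
    c ≤ 0 := by
  have hd : deriv k = k' := funext fun s => (h1 s).deriv
  by_contra! hc
  have hc' : deriv (deriv k) 0 = c := by rw [hd, h2.deriv]
  have hmin := isLocalMin_of_deriv_deriv_pos (hc'.symm ▸ hc) hm.deriv_eq_zero (h1 0).continuousAt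
  have heq : k =ᶠ[𝓝 0] fun _ => k 0 := by
    filter_upwards [hm, hmin] with s hs hs' using le_antisymm hs hs'
  have h0 : deriv (deriv k) 0 = 0 := by
    rw [heq.deriv.deriv_eq]; simp
  linarith

lemma deriv_nonpos_of_eventually_le_right {k : ℝ → ℝ} {c : ℝ} (h : HasDerivAt k c 0)
    (hm : ∀ᶠ s in 𝓝[>] (0 : ℝ), k s ≤ k 0) : c ≤ 0 := by
  have hsub : Set.Ioi (0 : ℝ) ⊆ {0}ᶜ := fun s hs => (Set.mem_Ioi.1 hs).ne'
  refine le_of_tendsto ((hasDerivAt_iff_tendsto_slope.1 h).mono_left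
    (nhdsWithin_mono (0 : ℝ) hsub)) ?_
  filter_upwards [hm, self_mem_nhdsWithin] with s h1 h2
  rw [Set.mem_Ioi] at h2
  rw [slope_def_field]
  exact div_nonpos_of_nonpos_of_nonneg (by linarith) (by linarith)

variable {E : Type*} [NormedAddCommGroup E] [NormedSpace ℝ E]

lemma ContDiff.hasDerivAt_line {w : E → ℝ} (hw : ContDiff ℝ 2 w) (x η : E) (s : ℝ) :
    HasDerivAt (fun s : ℝ => w (x + s • η)) (fderiv ℝ w (x + s • η) η) s := by
  have h1 : HasDerivAt (fun s : ℝ => x + s • η) η s := by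
    simpa using ((hasDerivAt_id s).smul_const η).const_add x
  exact ((hw.differentiable (by norm_num)) _).hasFDerivAt.comp_hasDerivAt s h1

lemma ContDiff.hasDerivAt_fderiv_line {w : E → ℝ} (hw : ContDiff ℝ 2 w) (x η : E) :
    HasDerivAt (fun s : ℝ => fderiv ℝ w (x + s • η) η) (fderiv ℝ (fderiv ℝ w) x η η) 0 := by
  have h1 : HasDerivAt (fun s : ℝ => x + s • η) η 0 := by
    simpa using ((hasDerivAt_id (0 : ℝ)).smul_const η).const_add x
  have h2 : Differentiable ℝ (fderiv ℝ w) :=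
    (hw.fderiv_right (m := 1) (by norm_num)).differentiable (by norm_num)
  have h3 := (h2 (x + (0 : ℝ) • η)).hasFDerivAt.comp_hasDerivAt (0 : ℝ) h1
  simpa using h3.clm_apply (hasDerivAt_const (0 : ℝ) η)

end SecondOrder

section Trace

variable {d : ℕ}

open scoped MatrixOrder Matrix.Norms.L2Operator in
lemma Matrix.PosSemidef.sum_mul_bilin_nonpos {a : Matrix (Fin d) (Fin d) ℝ} (ha : a.PosSemidef)
    (B : Euc d →L[ℝ] Euc d →L[ℝ] ℝ) (hB : ∀ η, B η η ≤ 0) :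
    ∑ i, ∑ j, a i j * B (EuclideanSpace.single j 1) (EuclideanSpace.single i 1) ≤ 0 := by
  classical
  obtain ⟨m, rfl⟩ := CStarAlgebra.nonneg_iff_eq_star_mul_self.mp ha.nonneg
  have key : ∀ k, B (∑ j, m k j • EuclideanSpace.single j (1 : ℝ))
      (∑ i, m k i • EuclideanSpace.single i (1 : ℝ)) = ∑ i, ∑ j, m k i * m k j *
        B (EuclideanSpace.single j 1) (EuclideanSpace.single i 1) := by
    intro k
    simp only [map_sum, map_smul, smul_eq_mul, _root_.sum_apply,
      _root_.smul_apply, Finset.mul_sum, mul_assoc]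
  calc _ = ∑ k, ∑ i, ∑ j, m k i * m k j *
        B (EuclideanSpace.single j 1) (EuclideanSpace.single i 1) := by
        simp only [Matrix.mul_apply, Matrix.star_eq_conjTranspose, Matrix.conjTranspose_apply, star_trivial, Finset.sum_mul]
        rw [Finset.sum_comm]
        conv_rhs => rw [Finset.sum_comm]
        conv_lhs => rw [Finset.sum_comm]
        exact Finset.sum_congr rfl fun i _ => Finset.sum_comm
    _ = ∑ k, B (∑ j, m k j • EuclideanSpace.single j (1 : ℝ))
      (∑ i, m k i • EuclideanSpace.single i (1 : ℝ)) := by simp only [key]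
    _ ≤ 0 := Finset.sum_nonpos fun k _ => hB _

lemma Matrix.PosDef.exists_pos_mul_sq_le {a : Matrix (Fin d) (Fin d) ℝ} (ha : a.PosDef) :
    ∃ θ > 0, ∀ η : Euc d, θ * ‖η‖ ^ 2 ≤ η.ofLp ⬝ᵥ (a.mulVec η.ofLp) := by
  have hcont : Continuous fun η : Euc d => η.ofLp ⬝ᵥ (a.mulVec η.ofLp) := by
    unfold Matrix.mulVec dotProduct
    fun_prop
  have hpos : ∀ η : Euc d, η ≠ 0 → 0 < η.ofLp ⬝ᵥ (a.mulVec η.ofLp) := by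
    intro η hη
    have := ha.dotProduct_mulVec_pos (x := η.ofLp) (by simpa using hη)
    simpa using this
  by_cases hne : (sphere (0 : Euc d) 1).Nonempty
  · obtain ⟨η₀, h₀, hmin⟩ := (isCompact_sphere (0 : Euc d) 1).exists_isMinOn hne hcont.continuousOn
    have hη₀ : η₀ ≠ 0 := by
      rintro rfl
      simp at h₀
    refine ⟨_, hpos η₀ hη₀, fun η => ?_⟩
    by_cases hη : η = 0
    · simp [hη]
    have hn : ‖η‖ ≠ 0 := norm_ne_zero_iff.2 hη
    have h1 := hmin (show ‖η‖⁻¹ • η ∈ sphere (0 : Euc d) 1 by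
      simp [norm_smul, hn])
    simp only [Set.mem_ofPred_eq, WithLp.ofLp_smul, Matrix.mulVec_smul, dotProduct_smul,
      smul_dotProduct, smul_eq_mul] at h1
    calc _ ≤ ‖η‖⁻¹ * (‖η‖⁻¹ * η.ofLp ⬝ᵥ (a.mulVec η.ofLp)) * ‖η‖ ^ 2 := by gcongr
      _ = _ := by field_simp
  · refine ⟨1, one_pos, fun η => ?_⟩
    by_cases hη : η = 0
    · simp [hη]
    refine absurd ⟨‖η‖⁻¹ • η, ?_⟩ hne
    simp [norm_smul, hη]

lemma Matrix.PosDef.exists_sum_mul_bilin_le {a : Matrix (Fin d) (Fin d) ℝ} (ha : a.PosDef) :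
    ∃ θ > 0, ∀ B : Euc d →L[ℝ] Euc d →L[ℝ] ℝ, (∀ η, B η η ≤ 0) → ∀ n : Euc d, ‖n‖ = 1 →
      ∑ i, ∑ j, a i j * B (EuclideanSpace.single j 1) (EuclideanSpace.single i 1)
        ≤ θ * B n n := by
  obtain ⟨θ, hθ, hle⟩ := ha.exists_pos_mul_sq_le
  refine ⟨θ, hθ, fun B hB n hn => ?_⟩
  have hps : (a - θ • Matrix.vecMulVec n.ofLp n.ofLp).PosSemidef := by
    refine Matrix.PosSemidef.of_dotProduct_mulVec_nonneg (ha.isHermitian.sub ?_) fun x => ?_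
    · ext i j
      simp [Matrix.vecMulVec_apply, mul_comm]
    · have h1 := hle (WithLp.toLp 2 x)
      have h2 : (n.ofLp ⬝ᵥ x) ^ 2 ≤ ‖(WithLp.toLp 2 x : Euc d)‖ ^ 2 := by
        have := abs_real_inner_le_norm (WithLp.toLp 2 x : Euc d) n
        rw [hn, mul_one] at this
        have h3 : inner ℝ (WithLp.toLp 2 x : Euc d) n = n.ofLp ⬝ᵥ x := by
          simp [EuclideanSpace.inner_eq_star_dotProduct]
        rw [← h3, ← sq_abs]
        gcongr
      have h4 : star x ⬝ᵥ (a - θ • Matrix.vecMulVec n.ofLp n.ofLp).mulVec x =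
          x ⬝ᵥ a.mulVec x - θ * (n.ofLp ⬝ᵥ x) ^ 2 := by
        simp only [star_trivial, Matrix.sub_mulVec, dotProduct_sub, Matrix.smul_mulVec,
          Matrix.vecMulVec_mulVec, dotProduct_smul, smul_eq_mul, MulOpposite.smul_eq_mul_unop,
          MulOpposite.unop_op]
        rw [dotProduct_comm x n.ofLp]
        ring
      rw [h4]
      simp only at h1
      nlinarith
  have h := hps.sum_mul_bilin_nonpos B hB
  have hnn : B n n = ∑ i, ∑ j, n i * n j *
      B (EuclideanSpace.single j 1) (EuclideanSpace.single i 1) := by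
    have hn' : n = ∑ i, n i • EuclideanSpace.single i (1 : ℝ) := by
      ext k
      simp [Pi.single_apply]
    conv_lhs => rw [hn']
    simp only [map_sum, map_smul, smul_eq_mul, _root_.sum_apply,
      _root_.smul_apply, Finset.mul_sum, mul_assoc]
  rw [hnn]
  have h5 : ∀ i j, (a - θ • Matrix.vecMulVec n.ofLp n.ofLp) i j *
      B (EuclideanSpace.single j 1) (EuclideanSpace.single i 1) =
      a i j * B (EuclideanSpace.single j 1) (EuclideanSpace.single i 1) -
      θ * (n i * n j * B (EuclideanSpace.single j 1) (EuclideanSpace.single i 1)) := by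
    intro i j
    simp only [Matrix.sub_apply, Matrix.smul_apply, Matrix.vecMulVec_apply, smul_eq_mul]
    ring
  simp only [h5, Finset.sum_sub_distrib, ← Finset.mul_sum] at h
  linarith

end Trace
section TorusProj

variable {d : ℕ}

lemma Torus.proj_add (y h : Euc d) : Torus.proj (y + h) = Torus.proj y + Torus.proj h := rfl

lemma Torus.isOpenQuotientMap_proj : IsOpenQuotientMap (Torus.proj (d := d)) :=
  (IsOpenQuotientMap.piMap fun _ => QuotientAddGroup.isOpenQuotientMap_mk).comp
    (PiLp.homeomorph 2 fun _ : Fin d => ℝ).isOpenQuotientMap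

lemma Torus.continuous_proj : Continuous (Torus.proj (d := d)) :=
  Torus.isOpenQuotientMap_proj.continuous

lemma Torus.proj_surjective : Function.Surjective (Torus.proj (d := d)) :=
  Torus.isOpenQuotientMap_proj.surjective

lemma continuous_of_tlift {v : Torus d → ℝ} (h : Continuous (tlift v)) : Continuous v :=
  Torus.isOpenQuotientMap_proj.continuous_comp_iff.1 h

lemma tlift_add_sub_eq (v : Torus d → ℝ) {y y' : Euc d} (h : Torus.proj y = Torus.proj y') :
    (fun x => tlift v (x + (y' - y))) = tlift v := by
  funext x
  have h0 : Torus.proj (y' - y) = 0 := by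
    have h1 := Torus.proj_add (y' - y) y
    rw [sub_add_cancel, h] at h1
    exact (left_eq_add.1 ((add_comm _ _).trans h1.symm).symm : _)
  rw [tlift, tlift, Torus.proj_add, h0, add_zero]

lemma fderiv_tlift_eq (v : Torus d → ℝ) {y y' : Euc d} (h : Torus.proj y = Torus.proj y') :
    fderiv ℝ (tlift v) y = fderiv ℝ (tlift v) y' := by
  have h1 := fderiv_comp_add_right (𝕜 := ℝ) (f := tlift v) (x := y) (y' - y)
  rw [tlift_add_sub_eq v h] at h1
  simpa using h1

lemma iteratedFDeriv_tlift_eq (v : Torus d → ℝ) (n : ℕ) {y y' : Euc d}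
    (h : Torus.proj y = Torus.proj y') :
    iteratedFDeriv ℝ n (tlift v) y = iteratedFDeriv ℝ n (tlift v) y' := by
  have h1 := iteratedFDeriv_comp_add_right (𝕜 := ℝ) (f := tlift v) n (y' - y) y
  rw [tlift_add_sub_eq v h] at h1
  simpa using h1

lemma trAH_tlift_eq (a : Matrix (Fin d) (Fin d) ℝ) (v : Torus d → ℝ) {y y' : Euc d}
    (h : Torus.proj y = Torus.proj y') : trAH a (tlift v) y = trAH a (tlift v) y' := by
  simp only [trAH, hess, iteratedFDeriv_tlift_eq v 2 h]

lemma norm_gradient_eq (f : Euc d → ℝ) (y : Euc d) : ‖gradient f y‖ = ‖fderiv ℝ f y‖ := by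
  simp [gradient]

lemma trAH_eq (a : Matrix (Fin d) (Fin d) ℝ) (v : Euc d → ℝ) (y : Euc d) :
    trAH a v y = ∑ i, ∑ j, a i j *
      fderiv ℝ (fderiv ℝ v) y (EuclideanSpace.single j 1) (EuclideanSpace.single i 1) := by
  simp only [trAH, hess, iteratedFDeriv_two_apply]
  rfl

lemma trAH_neg (a : Matrix (Fin d) (Fin d) ℝ) (v : Euc d → ℝ) (y : Euc d) :
    trAH a (-v) y = - trAH a v y := by
  have h : fderiv ℝ (-v) = -fderiv ℝ v := funext fun y => fderiv_neg
  have h2 : fderiv ℝ (-fderiv ℝ v) y = -fderiv ℝ (fderiv ℝ v) y := fderiv_neg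
  simp [trAH_eq, h, h2]

end TorusProj

section APriori

variable {d : ℕ} {a : Matrix (Fin d) (Fin d) ℝ} {δ M g : ℝ}

lemma sup_estimate_aux (ha : a.PosDef) (hδ : 0 < δ) {w : Torus d → ℝ}
    (hw : ContDiff ℝ 2 (tlift w))
    (h : ∀ y : Euc d, δ * tlift w y - trAH a (tlift w) y ≤ M * ‖fderiv ℝ (tlift w) y‖ + g)
    (t : Torus d) : w t ≤ g / δ := by
  obtain ⟨t₀, -, ht₀⟩ := isCompact_univ.exists_isMaxOn (Set.univ_nonempty (α := Torus d))
    (continuous_of_tlift hw.continuous).continuousOn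
  obtain ⟨y, rfl⟩ := Torus.proj_surjective t₀
  have hmax : ∀ z, tlift w z ≤ tlift w y := fun z => ht₀ (Set.mem_univ (Torus.proj z))
  have hD : fderiv ℝ (tlift w) y = 0 :=
    IsLocalMax.fderiv_eq_zero (Eventually.of_forall hmax)
  have hD2 : ∀ η, fderiv ℝ (fderiv ℝ (tlift w)) y η η ≤ 0 := fun η =>
    second_deriv_nonpos_of_isLocalMax (hw.hasDerivAt_line y η)
      (hw.hasDerivAt_fderiv_line y η) (Eventually.of_forall fun s => by simpa using hmax _)
  have htr := ha.posSemidef.sum_mul_bilin_nonpos _ hD2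
  rw [← trAH_eq] at htr
  have h1 := h y
  rw [hD, norm_zero, mul_zero, zero_add] at h1
  have h2 : w t ≤ tlift w y := ht₀ (Set.mem_univ t)
  rw [le_div_iff₀ hδ]
  nlinarith

lemma sup_estimate (ha : a.PosDef) (hδ : 0 < δ) {w : Torus d → ℝ} (hw : ContDiff ℝ 2 (tlift w))
    (h : ∀ y : Euc d, |δ * tlift w y - trAH a (tlift w) y| ≤ M * ‖fderiv ℝ (tlift w) y‖ + g)
    (t : Torus d) : |w t| ≤ g / δ := by
  have hneg : tlift (-w) = -tlift w := rfl
  refine abs_le'.2 ⟨sup_estimate_aux ha hδ hw (fun y => (le_abs_self _).trans (h y)) t,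
    sup_estimate_aux (w := -w) (M := M) ha hδ (hneg ▸ hw.neg) (fun y => ?_) t⟩
  rw [hneg, fderiv_neg, norm_neg, trAH_neg, Pi.neg_apply]
  refine le_trans (le_of_eq ?_) ((neg_le_abs _).trans (h y))
  ring

/-- The oscillation of a periodic function with controlled elliptic operator is dominated by any
strict supersolution `φ(|x - y|)` of the reflected one-dimensional inequality. -/
lemma doubling_estimate {θ : ℝ} (hθ : 0 < θ)
    (hB : ∀ B : Euc d →L[ℝ] Euc d →L[ℝ] ℝ, (∀ η, B η η ≤ 0) → ∀ n : Euc d, ‖n‖ = 1 →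
      ∑ i, ∑ j, a i j * B (EuclideanSpace.single j 1) (EuclideanSpace.single i 1) ≤ θ * B n n)
    (hδ : 0 < δ) (hM : 0 ≤ M) {w : Torus d → ℝ} (hw : ContDiff ℝ 2 (tlift w))
    (h : ∀ y : Euc d, |δ * tlift w y - trAH a (tlift w) y| ≤ M * ‖fderiv ℝ (tlift w) y‖ + g)
    {φ φ' φ'' : ℝ → ℝ} (hφ : ∀ r, HasDerivAt φ (φ' r) r) (hφ' : ∀ r, HasDerivAt φ' (φ'' r) r)
    (hφ0 : φ 0 = 0) (hφnn : ∀ r, 0 ≤ φ' r)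
    (hsup : ∀ t, |w t| ≤ g / δ) (hφ1 : 2 * (g / δ) ≤ φ 1)
    (hφeq : ∀ r ∈ Set.Ioo (0 : ℝ) 1, 4 * θ * φ'' r + 2 * M * φ' r + 2 * g ≤ 0)
    (X Y : Euc d) (hXY : ‖X - Y‖ ≤ 1) :
    tlift w X - tlift w Y ≤ φ ‖X - Y‖ := by
  by_contra! hcon
  have hwc := continuous_of_tlift hw.continuous
  have hφc : Continuous φ := continuous_iff_continuousAt.2 fun r => (hφ r).continuousAt
  have hmono : Monotone φ := monotone_of_deriv_nonneg (fun r => (hφ r).differentiableAt)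
    fun r => (hφ r).deriv ▸ hφnn r
  have hΨ : Continuous fun q : Torus d × Euc d => w (q.1 + Torus.proj q.2) - w q.1 - φ ‖q.2‖ := by
    have := Torus.continuous_proj (d := d)
    fun_prop
  obtain ⟨⟨t, k⟩, hmem, hmax⟩ := (isCompact_univ.prod (isCompact_closedBall (0 : Euc d) 1))
    |>.exists_isMaxOn (f := fun q : Torus d × Euc d => w (q.1 + Torus.proj q.2) - w q.1 - φ ‖q.2‖)
    ⟨(Torus.proj Y, X - Y), by simpa [mem_closedBall, dist_eq_norm] using hXY⟩ hΨ.continuousOn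
  obtain ⟨y, rfl⟩ := Torus.proj_surjective t
  obtain ⟨x, rfl⟩ : ∃ x, k = x - y := ⟨k + y, by simp⟩
  set W := tlift w with hW
  have hmaxW : ∀ X Y : Euc d, ‖X - Y‖ ≤ 1 →
      W X - W Y - φ ‖X - Y‖ ≤ W x - W y - φ ‖x - y‖ := by
    intro X Y hXY
    have h1 := hmax (show (Torus.proj Y, X - Y) ∈ Set.univ ×ˢ closedBall (0 : Euc d) 1 by
      simpa [mem_closedBall, dist_eq_norm] using hXY)
    simp only [Set.mem_ofPred_eq, ← Torus.proj_add, add_sub_cancel] at h1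
    exact h1
  have hpos : 0 < W x - W y - φ ‖x - y‖ := lt_of_lt_of_le (by linarith) (hmaxW X Y hXY)
  set r := ‖x - y‖ with hr
  have hr1 : r ≤ 1 := by simpa [mem_closedBall, dist_eq_norm] using hmem
  have hφr : 0 ≤ φ r := hφ0 ▸ hmono (norm_nonneg _)
  have hr0 : 0 < r := by
    refine lt_of_le_of_ne (norm_nonneg _) fun h0 => ?_
    have hxy : x = y := sub_eq_zero.1 (norm_eq_zero.1 h0.symm)
    rw [hxy] at hpos
    linarith
  have hr1 : r < 1 := by
    refine lt_of_le_of_ne hr1 fun h1 => ?_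
    rw [h1] at hpos
    have h2 := (abs_le.1 (hsup (Torus.proj x))).2
    have h3 := (abs_le.1 (hsup (Torus.proj y))).1
    simp only [hW, tlift] at hpos
    linarith
  have hdiag : ∀ η, IsLocalMax (fun s : ℝ => W (x + s • η) - W (y + s • η)) 0 := fun η =>
    Eventually.of_forall fun s => by
      have := hmaxW (x + s • η) (y + s • η) (by simpa [← hr] using hr1.le)
      simp only [add_sub_add_right_eq_sub] at this
      simp only [zero_smul, add_zero]
      linarith
  have hgrad : fderiv ℝ W x = fderiv ℝ W y := by
    ext η
    have h1 := (hdiag η).hasDerivAt_eq_zero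
      ((hw.hasDerivAt_line x η 0).sub (hw.hasDerivAt_line y η 0))
    simp only [zero_smul, add_zero] at h1
    linarith
  have hZ : ∀ η, (fderiv ℝ (fderiv ℝ W) x - fderiv ℝ (fderiv ℝ W) y) η η ≤ 0 := fun η =>
    second_deriv_nonpos_of_isLocalMax
      (fun s => (hw.hasDerivAt_line x η s).sub (hw.hasDerivAt_line y η s))
      ((hw.hasDerivAt_fderiv_line x η).sub (hw.hasDerivAt_fderiv_line y η)) (hdiag η)
  set n : Euc d := r⁻¹ • (x - y) with hn
  have hn1 : ‖n‖ = 1 := by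
    rw [hn, norm_smul, ← hr, norm_inv, Real.norm_of_nonneg hr0.le, inv_mul_cancel₀ hr0.ne']
  have hxyn : x - y = r • n := by rw [hn, smul_inv_smul₀ hr0.ne']
  have hrefl : IsLocalMax (fun s : ℝ => W (x + s • n) - W (y + s • -n) - φ (r + 2 * s)) 0 := by
    have h1 : ∀ᶠ s : ℝ in 𝓝 0, 0 < r + 2 * s ∧ r + 2 * s < 1 := by
      have hc : Continuous fun s : ℝ => r + 2 * s := by fun_prop
      exact (hc.continuousAt.eventually (lt_mem_nhds (by simpa using hr0))).and
        (hc.continuousAt.eventually (gt_mem_nhds (by simpa using hr1)))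
    filter_upwards [h1] with s hs
    have h2 : ‖x + s • n - (y + s • -n)‖ = r + 2 * s := by
      have : x + s • n - (y + s • -n) = (r + 2 * s) • n := by
        rw [add_smul, ← hxyn, smul_neg, mul_smul, two_smul]
        abel
      rw [this, norm_smul, hn1, Real.norm_of_nonneg hs.1.le, mul_one]
    have h3 := hmaxW (x + s • n) (y + s • -n) (h2 ▸ hs.2.le)
    rw [h2] at h3
    simpa using h3
  have hlin : ∀ s : ℝ, HasDerivAt (fun s : ℝ => r + 2 * s) 2 s := fun s => by
    simpa using ((hasDerivAt_id s).const_mul 2).const_add r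
  have hZn : (fderiv ℝ (fderiv ℝ W) x - fderiv ℝ (fderiv ℝ W) y) n n ≤ 4 * φ'' r := by
    have h1 := second_deriv_nonpos_of_isLocalMax
      (fun s => ((hw.hasDerivAt_line x n s).sub (hw.hasDerivAt_line y (-n) s)).sub
        ((hφ (r + 2 * s)).comp s (hlin s)))
      (((hw.hasDerivAt_fderiv_line x n).sub (hw.hasDerivAt_fderiv_line y (-n))).sub
        (((hφ' (r + 2 * 0)).comp 0 (hlin 0)).mul_const 2)) hrefl
    simp only [map_neg, neg_apply, neg_neg, mul_zero, add_zero] at h1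
    simp only [sub_apply]
    linarith
  have hq : ‖fderiv ℝ W x‖ ≤ φ' r := by
    have h1 : ∀ η, fderiv ℝ W x η ≤ φ' r * ‖η‖ := by
      intro η
      have hl : HasDerivAt (fun s : ℝ => r + s * ‖η‖) ‖η‖ 0 := by
        simpa using ((hasDerivAt_id (0 : ℝ)).mul_const ‖η‖).const_add r
      have h2 := deriv_nonpos_of_eventually_le_right
        ((hw.hasDerivAt_line x η 0).sub ((hφ (r + 0 * ‖η‖)).comp 0 hl)) ?_
      · simp only [zero_smul, add_zero, zero_mul] at h2
        linarith
      have hc : Continuous fun s : ℝ => r + s * ‖η‖ := by fun_prop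
      have hev : ∀ᶠ s : ℝ in 𝓝 0, r + s * ‖η‖ < 1 :=
        hc.continuousAt.eventually (gt_mem_nhds (by simpa using hr1))
      filter_upwards [hev.filter_mono nhdsWithin_le_nhds, self_mem_nhdsWithin] with s hs hs0
      rw [Set.mem_Ioi] at hs0
      have h3 : ‖x + s • η - y‖ ≤ r + s * ‖η‖ := by
        calc ‖x + s • η - y‖ = ‖(x - y) + s • η‖ := by congr 1; abel
          _ ≤ ‖x - y‖ + ‖s • η‖ := norm_add_le _ _
          _ = _ := by rw [norm_smul, Real.norm_of_nonneg hs0.le]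
      have h4 := hmaxW (x + s • η) y (h3.trans hs.le)
      have h5 := hmono h3
      simp only [Pi.sub_apply, Function.comp_apply, zero_smul, add_zero, zero_mul]
      linarith
    refine ContinuousLinearMap.opNorm_le_bound _ (hφnn r) fun η => ?_
    rw [Real.norm_eq_abs]
    refine abs_le'.2 ⟨h1 η, ?_⟩
    simpa using h1 (-η)
  have htr := hB _ hZ n hn1
  have hsplit : ∑ i, ∑ j, a i j * (fderiv ℝ (fderiv ℝ W) x - fderiv ℝ (fderiv ℝ W) y)
      (EuclideanSpace.single j 1) (EuclideanSpace.single i 1) = trAH a W x - trAH a W y := by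
    simp only [trAH_eq, sub_apply, mul_sub, Finset.sum_sub_distrib]
  rw [hsplit] at htr
  have hx := (abs_le.1 (h x)).2
  have hy := (abs_le.1 (h y)).1
  rw [← hgrad] at hy
  have h1 := hφeq r ⟨hr0, hr1⟩
  have h2 : M * ‖fderiv ℝ W x‖ ≤ M * φ' r := by gcongr
  have h3 : θ * (fderiv ℝ (fderiv ℝ W) x - fderiv ℝ (fderiv ℝ W) y) n n ≤ θ * (4 * φ'' r) := by
    gcongr
  have h4 : 0 < δ * (W x - W y) := mul_pos hδ (by linarith)
  nlinarith

lemma gradient_estimate (ha : a.PosDef) (hδ : 0 < δ) (hM : 0 ≤ M) :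
    ∃ C, 0 ≤ C ∧ ∀ w : Torus d → ℝ, ContDiff ℝ 2 (tlift w) → ∀ g : ℝ, 0 ≤ g →
      (∀ y : Euc d, |δ * tlift w y - trAH a (tlift w) y| ≤ M * ‖fderiv ℝ (tlift w) y‖ + g) →
      (∀ t, |w t| ≤ C * g) ∧ ∀ y : Euc d, ‖fderiv ℝ (tlift w) y‖ ≤ C * g := by
  obtain ⟨θ, hθ, hB⟩ := ha.exists_sum_mul_bilin_le
  set κ := (M + 1) / θ with hκ
  have hκ0 : 0 < κ := by positivity
  have hκθ : θ * κ = M + 1 := by rw [hκ]; field_simp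
  have he1 : 0 < 1 - Real.exp (-κ) := by
    simpa using hκ0
  set b := Real.exp κ / κ + 2 / (δ * (1 - Real.exp (-κ))) with hb
  have hb0 : 0 < b := by positivity
  refine ⟨1 / δ + b * κ, by positivity, fun w hw g hg h => ?_⟩
  have hsup := sup_estimate ha hδ hw h
  refine ⟨fun t => (hsup t).trans ?_, fun y => ?_⟩
  · rw [add_mul, one_div, div_eq_inv_mul]
    have : 0 ≤ b * κ * g := by positivity
    linarith
  have hlip : ∀ X Y : Euc d, ‖X - Y‖ ≤ 1 →
      tlift w X - tlift w Y ≤ b * g * (1 - Real.exp (-κ * ‖X - Y‖)) := by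
    have hexp : ∀ r : ℝ, HasDerivAt (fun r : ℝ => Real.exp (-κ * r))
        (Real.exp (-κ * r) * -κ) r := fun r => by
      simpa using ((hasDerivAt_id r).const_mul (-κ)).exp
    refine doubling_estimate (φ := fun r => b * g * (1 - Real.exp (-κ * r)))
      (φ' := fun r => b * g * κ * Real.exp (-κ * r))
      (φ'' := fun r => - (b * g * κ ^ 2 * Real.exp (-κ * r)))
      hθ hB hδ hM hw h (fun r => ?_) (fun r => ?_) (by simp) (fun r => by positivity) hsup ?_ ?_
    · convert! ((hexp r).const_sub 1).const_mul (b * g) using 1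
      ring
    · convert! (hexp r).const_mul (b * g * κ) using 1
      ring
    · have h1 : 2 / (δ * (1 - Real.exp (-κ))) ≤ b := by
        rw [hb]; exact le_add_of_nonneg_left (by positivity)
      calc 2 * (g / δ) = 2 / (δ * (1 - Real.exp (-κ))) * g * (1 - Real.exp (-κ)) := by
            field_simp
        _ ≤ b * g * (1 - Real.exp (-κ)) := by gcongr
        _ = _ := by simp
    · intro r hr
      have h1 : Real.exp (-κ) ≤ Real.exp (-κ * r) := by
        rw [Real.exp_le_exp]
        nlinarith [hr.2]
      have h2 : Real.exp κ / κ ≤ b := by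
        rw [hb]; exact le_add_of_nonneg_right (by positivity)
      have h3 : g ≤ b * g * κ * Real.exp (-κ * r) := by
        calc g = Real.exp κ / κ * g * κ * Real.exp (-κ) := by
              rw [Real.exp_neg]; field_simp
          _ ≤ b * g * κ * Real.exp (-κ * r) := by gcongr
      have h4 : 4 * θ * -(b * g * κ ^ 2 * Real.exp (-κ * r)) =
          -(4 * (θ * κ) * (b * g * κ * Real.exp (-κ * r))) := by ring
      rw [h4, hκθ]
      nlinarith [mul_nonneg hM (hg.trans h3)]
  have hlip' : ∀ X Y : Euc d, ‖X - Y‖ ≤ 1 → tlift w X - tlift w Y ≤ b * g * κ * ‖X - Y‖ := by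
    intro X Y hXY
    refine (hlip X Y hXY).trans ?_
    have h1 := Real.add_one_le_exp (-κ * ‖X - Y‖)
    have h2 : 0 ≤ b * g := by positivity
    nlinarith
  have hle : ‖fderiv ℝ (tlift w) y‖ ≤ b * g * κ := by
    refine norm_fderiv_le_of_lip' ℝ (by positivity) ?_
    filter_upwards [closedBall_mem_nhds y one_pos] with z hz
    rw [mem_closedBall, dist_eq_norm] at hz
    rw [Real.norm_eq_abs]
    refine abs_le'.2 ⟨hlip' z y hz, ?_⟩
    rw [norm_sub_rev] at hz
    rw [neg_sub, norm_sub_rev]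
    exact hlip' y z hz
  refine hle.trans ?_
  have : 0 ≤ 1 / δ * g := by positivity
  linarith

end APriori
section Nemytskii

variable {K : Type*} [TopologicalSpace K] {E F : Type*}

/-- The superposition operator `U ↦ (y ↦ f(y, U(y)))` on continuous functions. -/
def nemytskii [TopologicalSpace E] [TopologicalSpace F] (f : K → E → F)
    (hf : Continuous (Function.uncurry f)) (U : C(K, E)) : C(K, F) :=
  ⟨fun y => f y (U y), hf.comp (continuous_id.prodMk U.continuous)⟩

lemma nemytskii_apply [TopologicalSpace E] [TopologicalSpace F] (f : K → E → F)
    (hf : Continuous (Function.uncurry f)) (U : C(K, E)) (y : K) :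
    nemytskii f hf U y = f y (U y) := rfl

variable [CompactSpace K] [NormedAddCommGroup E] [NormedAddCommGroup F]

lemma continuous_nemytskii (f : K → E → F) (hf : Continuous (Function.uncurry f)) :
    Continuous (nemytskii f hf) := by
  refine ContinuousMap.continuous_of_continuous_uncurry _ ?_
  exact hf.comp (continuous_snd.prodMk (continuous_eval (F := C(K, E))))

variable [NormedSpace ℝ E] [NormedSpace ℝ F]

/-- Pointwise application of a continuous family of operators to a continuous function. -/
def pointwiseCLM (b : C(K, E →L[ℝ] F)) : C(K, E) →L[ℝ] C(K, F) :=
  LinearMap.mkContinuous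
    { toFun := fun V => ⟨fun y => b y (V y), b.continuous.clm_apply V.continuous⟩
      map_add' := fun _ _ => by ext; simp
      map_smul' := fun _ _ => by ext; simp } ‖b‖ fun V => by
    refine (ContinuousMap.norm_le _ (by positivity)).2 fun y => ?_
    exact ((b y).le_opNorm _).trans (mul_le_mul (b.norm_coe_le_norm y) (V.norm_coe_le_norm y)
      (norm_nonneg _) (norm_nonneg b))

lemma pointwiseCLM_apply (b : C(K, E →L[ℝ] F)) (V : C(K, E)) (y : K) :
    pointwiseCLM b V y = b y (V y) := rfl

lemma isBoundedLinearMap_pointwiseCLM :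
    IsBoundedLinearMap ℝ fun b : C(K, E →L[ℝ] F) => pointwiseCLM b := by
  refine IsLinearMap.with_bound ⟨fun b c => ?_, fun r b => ?_⟩ 1 fun b => ?_
  · ext V y; rfl
  · ext V y; rfl
  · rw [one_mul]
    exact LinearMap.mkContinuous_norm_le _ (norm_nonneg b) _

lemma hasFDerivAt_nemytskii {f : K → E → F} {f' : K → E → E →L[ℝ] F}
    (hf : Continuous (Function.uncurry f)) (hf' : Continuous (Function.uncurry f'))
    (hd : ∀ y e, HasFDerivAt (f y) (f' y e) e) (U : C(K, E)) :
    HasFDerivAt (nemytskii f hf) (pointwiseCLM (nemytskii f' hf' U)) U := by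
  rw [hasFDerivAt_iff_isLittleO_nhds_zero, Asymptotics.isLittleO_iff]
  intro ε hε
  obtain ⟨r, hr, hball⟩ := Metric.continuousAt_iff.1
    ((continuous_nemytskii f' hf').continuousAt (x := U)) ε hε
  filter_upwards [ball_mem_nhds (0 : C(K, E)) hr] with V hV
  rw [mem_ball_zero_iff] at hV
  refine (ContinuousMap.norm_le _ (by positivity)).2 fun y => ?_
  simp only [ContinuousMap.sub_apply, nemytskii_apply, ContinuousMap.add_apply, pointwiseCLM_apply]
  have hseg : ∀ e ∈ segment ℝ (U y) (U y + V y), ‖f' y e - f' y (U y)‖ ≤ ε := by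
    intro e he
    rw [segment_eq_image'] at he
    obtain ⟨t, ht, rfl⟩ := he
    simp only [add_sub_cancel_left]
    have h1 : dist (U + t • V) U < r := by
      rw [dist_eq_norm, add_sub_cancel_left, norm_smul, Real.norm_of_nonneg ht.1]
      exact (mul_le_of_le_one_left (norm_nonneg _) ht.2).trans_lt hV
    have h2 := (ContinuousMap.dist_apply_le_dist y).trans (hball h1).le
    simpa [dist_eq_norm, nemytskii_apply] using h2
  have h3 := (convex_segment (U y) (U y + V y)).norm_image_sub_le_of_norm_hasFDerivWithin_le'
    (f := f y) (f' := f' y) (φ := f' y (U y)) (fun e _ => (hd y e).hasFDerivWithinAt) hseg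
    (left_mem_segment ℝ _ _) (right_mem_segment ℝ _ _)
  rw [add_sub_cancel_left] at h3
  exact h3.trans (by gcongr; exact V.norm_coe_le_norm y)

lemma contDiff_one_nemytskii {f : K → E → F} {f' : K → E → E →L[ℝ] F}
    (hf : Continuous (Function.uncurry f)) (hf' : Continuous (Function.uncurry f'))
    (hd : ∀ y e, HasFDerivAt (f y) (f' y e) e) : ContDiff ℝ 1 (nemytskii f hf) :=
  contDiff_one_iff_hasFDerivAt.2 ⟨_, isBoundedLinearMap_pointwiseCLM.continuous.comp (continuous_nemytskii f' hf'),
    hasFDerivAt_nemytskii hf hf' hd⟩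

lemma contDiff_two_nemytskii {f : K → E → F} {f' : K → E → E →L[ℝ] F}
    {f'' : K → E → E →L[ℝ] E →L[ℝ] F}
    (hf : Continuous (Function.uncurry f)) (hf' : Continuous (Function.uncurry f'))
    (hf'' : Continuous (Function.uncurry f''))
    (hd : ∀ y e, HasFDerivAt (f y) (f' y e) e) (hd' : ∀ y e, HasFDerivAt (f' y) (f'' y e) e) :
    ContDiff ℝ 2 (nemytskii f hf) := by
  have h0 : ContDiff ℝ 1 fun b : C(K, E →L[ℝ] F) => pointwiseCLM b :=
    isBoundedLinearMap_pointwiseCLM.contDiff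
  have h1 : ContDiff ℝ 1 fun U => pointwiseCLM (nemytskii f' hf' U) :=
    h0.comp (contDiff_one_nemytskii hf' hf'' hd')
  have h : ContDiff ℝ (1 + 1) (nemytskii f hf) :=
    (contDiff_succ_iff_hasFDerivAt (n := 1)).2 ⟨_, h1, hasFDerivAt_nemytskii hf hf' hd⟩
  simpa [one_add_one_eq_two] using h

end Nemytskii

section MethodOfContinuity

variable {Y : Type*} [NormedAddCommGroup Y] [NormedSpace ℝ Y] [CompleteSpace Y]

lemma isUnit_of_dist_le {S T : Y →L[ℝ] Y} {C : ℝ} (hS : IsUnit S) (hC : 0 < C)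
    (hlow : ∀ x, ‖x‖ ≤ C * ‖S x‖) (hT : ‖T - S‖ < C⁻¹) : IsUnit T := by
  obtain ⟨u, rfl⟩ := hS
  nontriviality Y →L[ℝ] Y
  refine (Units.ofNearby u T (hT.trans_le ?_)).isUnit
  refine inv_anti₀ (Units.norm_pos _) (ContinuousLinearMap.opNorm_le_bound _ hC.le fun x => ?_)
  have h1 := hlow ((↑u⁻¹ : Y →L[ℝ] Y) x)
  have h2 : (u : Y →L[ℝ] Y) ((↑u⁻¹ : Y →L[ℝ] Y) x) = x := by
    rw [← mul_apply_eq_comp, u.mul_inv, one_apply_eq_self]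
  rwa [h2] at h1

/-- The method of continuity for the segment `1 + t B`, `t ∈ [0, 1]`. -/
lemma isUnit_one_add_of_lower_bound (B : Y →L[ℝ] Y) {C : ℝ} (hC : 0 < C)
    (hlow : ∀ t ∈ Set.Icc (0 : ℝ) 1, ∀ x, ‖x‖ ≤ C * ‖x + t • B x‖) : IsUnit (1 + B) := by
  obtain ⟨N, hN⟩ := exists_nat_gt (C * ‖B‖)
  have hN0 : (0 : ℝ) < N := lt_of_le_of_lt (by positivity) hN
  have key : ∀ k : ℕ, k ≤ N → IsUnit (1 + ((k : ℝ) / N) • B) := by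
    intro k
    induction k with
    | zero => intro _; simp
    | succ k ih =>
      intro hk
      have hkN : (k : ℝ) ≤ N := by exact_mod_cast (Nat.le_succ k).trans hk
      refine isUnit_of_dist_le (ih ((Nat.le_succ k).trans hk)) hC (fun x => ?_) ?_
      · simpa using hlow ((k : ℝ) / N) ⟨by positivity, (div_le_one hN0).2 hkN⟩ x
      · have h1 : (1 + (((k + 1 : ℕ) : ℝ) / N) • B) - (1 + ((k : ℝ) / N) • B)
            = (N : ℝ)⁻¹ • B := by
          rw [add_sub_add_left_eq_sub, ← sub_smul]
          congr 1
          push_cast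
          field_simp
          ring
        rw [h1, norm_smul, norm_inv, Real.norm_of_nonneg hN0.le, inv_mul_eq_div, div_lt_iff₀ hN0,
          ← div_eq_inv_mul, lt_div_iff₀ hC, mul_comm]
        exact hN
  simpa [hN0.ne'] using key N le_rfl

end MethodOfContinuity

section Multilinear

lemma continuous_multilinear_of_forall_apply {X V G : Type*} [TopologicalSpace X]
    [NormedAddCommGroup V] [NormedSpace ℝ V] [FiniteDimensional ℝ V]
    [NormedAddCommGroup G] [NormedSpace ℝ G] (n : ℕ)
    (T : X → ContinuousMultilinearMap ℝ (fun _ : Fin n => V) G)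
    (hT : ∀ m, Continuous fun x => T x m) : Continuous T := by
  induction n with
  | zero =>
    have h : T = fun x => (continuousMultilinearCurryFin0 ℝ V G).symm (T x 0) := by
      funext x
      exact ((continuousMultilinearCurryFin0 ℝ V G).symm_apply_apply (T x)).symm
    rw [h]
    exact (LinearIsometryEquiv.continuous _).comp (hT 0)
  | succ n ih =>
    have h : T = fun x => (continuousMultilinearCurryLeftEquiv ℝ (fun _ : Fin (n + 1) => V) G).symm
        (T x).curryLeft := by
      funext x
      exact ((T x).uncurry_curryLeft).symm
    rw [h]
    refine (LinearIsometryEquiv.continuous _).comp (continuous_clm_apply.2 fun p => ih _ fun m => ?_)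
    exact hT (Fin.cons p m)

end Multilinear

section Resolvent

variable {d : ℕ}

/-- A continuous periodic function on `ℝ^d` descends to the torus. -/
def Torus.descend {G : Type*} [TopologicalSpace G] (f : Euc d → G) (hf : Continuous f)
    (hper : ∀ ⦃y y'⦄, Torus.proj y = Torus.proj y' → f y = f y') : C(Torus d, G) :=
  (show Topology.IsQuotientMap (⟨Torus.proj, Torus.continuous_proj⟩ : C(Euc d, Torus d)) from
    Torus.isOpenQuotientMap_proj.isQuotientMap).lift ⟨f, hf⟩ hper

lemma Torus.descend_proj {G : Type*} [TopologicalSpace G] (f : Euc d → G) (hf : Continuous f)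
    (hper : ∀ ⦃y y'⦄, Torus.proj y = Torus.proj y' → f y = f y') (y : Euc d) :
    Torus.descend f hf hper (Torus.proj y) = f y :=
  DFunLike.congr_fun ((show Topology.IsQuotientMap
    (⟨Torus.proj, Torus.continuous_proj⟩ : C(Euc d, Torus d)) from
    Torus.isOpenQuotientMap_proj.isQuotientMap).lift_comp ⟨f, hf⟩ hper) y

lemma Torus.ext_proj {G : Type*} [TopologicalSpace G] {f g : C(Torus d, G)}
    (h : ∀ y, f (Torus.proj y) = g (Torus.proj y)) : f = g :=
  ContinuousMap.ext fun t => by obtain ⟨y, rfl⟩ := Torus.proj_surjective t; exact h y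

lemma Torus.norm_le {G : Type*} [SeminormedAddCommGroup G] {f : C(Torus d, G)} {C : ℝ}
    (hC : 0 ≤ C) (h : ∀ y, ‖f (Torus.proj y)‖ ≤ C) : ‖f‖ ≤ C :=
  (ContinuousMap.norm_le _ hC).2 fun t => by obtain ⟨y, rfl⟩ := Torus.proj_surjective t; exact h y

variable (d) in
/-- The space `C²(𝕋^d)` inside `C(𝕋^d)`. -/
def C2Torus : Submodule ℝ C(Torus d, ℝ) where
  carrier := {w | ContDiff ℝ 2 (tlift w)}
  add_mem' := fun {w w'} (h : ContDiff ℝ 2 (tlift w)) (h' : ContDiff ℝ 2 (tlift w')) => h.add h'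
  zero_mem' := (contDiff_const : ContDiff ℝ 2 fun _ : Euc d => (0 : ℝ))
  smul_mem' := fun r w (h : ContDiff ℝ 2 (tlift w)) =>
    (h.const_smul r : ContDiff ℝ 2 (r • tlift w))

lemma C2Torus.contDiff (w : C2Torus d) : ContDiff ℝ 2 (tlift w.1) := w.2

lemma C2Torus.differentiable (w : C2Torus d) : Differentiable ℝ (tlift w.1) :=
  (C2Torus.contDiff w).differentiable (by norm_num)

lemma C2Torus.differentiable_fderiv (w : C2Torus d) : Differentiable ℝ (fderiv ℝ (tlift w.1)) :=
  ((C2Torus.contDiff w).fderiv_right (m := 1) (by norm_num)).differentiable (by norm_num)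

lemma C2Torus.fderiv_add (w w' : C2Torus d) :
    fderiv ℝ (tlift (w + w').1) = fderiv ℝ (tlift w.1) + fderiv ℝ (tlift w'.1) :=
  funext fun y => _root_.fderiv_add (C2Torus.differentiable w y) (C2Torus.differentiable w' y)

lemma C2Torus.fderiv_smul (r : ℝ) (w : C2Torus d) :
    fderiv ℝ (tlift (r • w).1) = r • fderiv ℝ (tlift w.1) :=
  funext fun y => fderiv_const_smul (C2Torus.differentiable w y) r

lemma C2Torus.trAH_add (a : Matrix (Fin d) (Fin d) ℝ) (w w' : C2Torus d) (y : Euc d) :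
    trAH a (tlift (w + w').1) y = trAH a (tlift w.1) y + trAH a (tlift w'.1) y := by
  simp only [trAH_eq, C2Torus.fderiv_add]
  rw [_root_.fderiv_add (C2Torus.differentiable_fderiv w y) (C2Torus.differentiable_fderiv w' y)]
  simp only [add_apply, mul_add, Finset.sum_add_distrib]

lemma C2Torus.trAH_smul (a : Matrix (Fin d) (Fin d) ℝ) (r : ℝ) (w : C2Torus d) (y : Euc d) :
    trAH a (tlift (r • w).1) y = r * trAH a (tlift w.1) y := by
  simp only [trAH_eq, C2Torus.fderiv_smul]
  rw [fderiv_const_smul (C2Torus.differentiable_fderiv w y) r]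
  simp only [smul_apply, smul_eq_mul, Finset.mul_sum]
  exact Finset.sum_congr rfl fun i _ => Finset.sum_congr rfl fun j _ => by ring

lemma continuous_trAH (a : Matrix (Fin d) (Fin d) ℝ) {v : Euc d → ℝ} (hv : ContDiff ℝ 2 v) :
    Continuous (trAH a v) := by
  have h := hv.continuous_iteratedFDeriv (m := 2) le_rfl
  unfold trAH hess
  fun_prop

lemma gradient_tlift_eq (v : Torus d → ℝ) {y y' : Euc d} (h : Torus.proj y = Torus.proj y') :
    gradient (tlift v) y = gradient (tlift v) y' := by
  simp only [gradient, fderiv_tlift_eq v h]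

lemma continuous_gradient {v : Euc d → ℝ} (hv : ContDiff ℝ 2 v) : Continuous (gradient v) :=
  (InnerProductSpace.toDual ℝ (Euc d)).symm.continuous.comp (hv.continuous_fderiv (by norm_num))

/-- The operator `w ↦ δ w - tr(a D²w)` from `C²(𝕋^d)` to `C(𝕋^d)`. -/
def ellipticOp (a : Matrix (Fin d) (Fin d) ℝ) (δ : ℝ) : C2Torus d →ₗ[ℝ] C(Torus d, ℝ) where
  toFun w := Torus.descend (fun y => δ * tlift w.1 y - trAH a (tlift w.1) y)
    ((continuous_const.mul (C2Torus.contDiff w).continuous).sub (continuous_trAH a (C2Torus.contDiff w)))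
    fun y y' h => by rw [trAH_tlift_eq a _ h, tlift, tlift, h]
  map_add' w w' := Torus.ext_proj fun y => by
    simp only [ContinuousMap.add_apply, Torus.descend_proj, C2Torus.trAH_add]
    change δ * (tlift w.1 y + tlift w'.1 y) - _ = _
    ring
  map_smul' r w := Torus.ext_proj fun y => by
    simp only [ContinuousMap.smul_apply, Torus.descend_proj, C2Torus.trAH_smul, smul_eq_mul,
      RingHom.id_apply]
    change δ * (r * tlift w.1 y) - _ = _
    ring

lemma ellipticOp_proj (a : Matrix (Fin d) (Fin d) ℝ) (δ : ℝ) (w : C2Torus d) (y : Euc d) :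
    ellipticOp a δ w (Torus.proj y) = δ * tlift w.1 y - trAH a (tlift w.1) y :=
  Torus.descend_proj _ _ _ y

/-- The gradient as an operator from `C²(𝕋^d)` to continuous vector fields. -/
def gradientOp : C2Torus d →ₗ[ℝ] C(Torus d, Euc d) where
  toFun w := Torus.descend (gradient (tlift w.1)) (continuous_gradient (C2Torus.contDiff w))
    fun _ _ h => gradient_tlift_eq _ h
  map_add' w w' := Torus.ext_proj fun y => by
    simp only [ContinuousMap.add_apply, Torus.descend_proj, gradient, C2Torus.fderiv_add,
      Pi.add_apply, map_add]
  map_smul' r w := Torus.ext_proj fun y => by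
    simp only [ContinuousMap.smul_apply, Torus.descend_proj, gradient, C2Torus.fderiv_smul,
      Pi.smul_apply, map_smul, RingHom.id_apply]

lemma gradientOp_proj (w : C2Torus d) (y : Euc d) :
    gradientOp w (Torus.proj y) = gradient (tlift w.1) y :=
  Torus.descend_proj _ _ _ y

lemma trAH_comp_linear (a : Matrix (Fin d) (Fin d) ℝ) {φ φ' : ℝ → ℝ}
    (h1 : ∀ s, HasDerivAt φ (φ' s) s) (h2 : ∀ s, HasDerivAt φ' (-φ s) s) (l : Euc d →L[ℝ] ℝ)
    (y : Euc d) :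
    trAH a (fun y => φ (l y)) y = -(∑ i, ∑ j, a i j *
      (l (EuclideanSpace.single j 1) * l (EuclideanSpace.single i 1))) * φ (l y) := by
  have e1 : fderiv ℝ (fun y => φ (l y)) = fun y => φ' (l y) • l :=
    funext fun y => ((h1 (l y)).comp_hasFDerivAt y l.hasFDerivAt).fderiv
  have e2 : fderiv ℝ (fun y => φ' (l y) • l) y = (-φ (l y) • l).smulRight l :=
    (((h2 (l y)).comp_hasFDerivAt y l.hasFDerivAt).smul_const l).fderiv
  rw [trAH_eq, e1, e2, ← Finset.sum_neg_distrib, Finset.sum_mul]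
  refine Finset.sum_congr rfl fun i _ => ?_
  rw [← Finset.sum_neg_distrib, Finset.sum_mul]
  refine Finset.sum_congr rfl fun j _ => ?_
  simp only [ContinuousLinearMap.smulRight_apply, smul_apply, smul_eq_mul]
  ring

lemma mem_range_ellipticOp_of_wave {a : Matrix (Fin d) (Fin d) ℝ} (ha : a.PosDef) {δ : ℝ}
    (hδ : 0 < δ) {φ φ' : ℝ → ℝ} (hφ : ContDiff ℝ 2 φ)
    (h1 : ∀ s, HasDerivAt φ (φ' s) s) (h2 : ∀ s, HasDerivAt φ' (-φ s) s) (l : Euc d →L[ℝ] ℝ)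
    (w : C(Torus d, ℝ)) (hw : tlift w = fun y => φ (l y)) :
    w ∈ LinearMap.range (ellipticOp a δ) := by
  set Q := ∑ i, ∑ j, a i j *
      (l (EuclideanSpace.single j 1) * l (EuclideanSpace.single i 1)) with hQ
  have hQ0 : 0 ≤ Q := by
    have h := ha.posSemidef.sum_mul_bilin_nonpos (-(l.smulRight l)) fun η => by
      simpa using mul_self_nonneg (l η)
    simpa [hQ] using h
  have hmem : w ∈ C2Torus d := by
    change ContDiff ℝ 2 (tlift w)
    rw [hw]
    exact hφ.comp l.contDiff
  have heq : ellipticOp a δ ⟨w, hmem⟩ = (δ + Q) • w := Torus.ext_proj fun y => by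
    rw [ellipticOp_proj]
    simp only [hw, trAH_comp_linear a h1 h2 l, ← hQ, ContinuousMap.smul_apply, smul_eq_mul]
    rw [show w (Torus.proj y) = φ (l y) from congrFun hw y]
    ring
  refine ⟨(δ + Q)⁻¹ • ⟨w, hmem⟩, ?_⟩
  rw [map_smul, heq, inv_smul_smul₀ (by positivity)]

/-- The real-linear form `y ↦ 2π n·y`. -/
def waveForm (n : Fin d → ℤ) : Euc d →L[ℝ] ℝ :=
  ∑ i, (2 * Real.pi * n i) • EuclideanSpace.proj i

lemma mFourier_proj (n : Fin d → ℤ) (y : Euc d) :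
    UnitAddTorus.mFourier n (Torus.proj y) = Complex.exp (waveForm n y * Complex.I) := by
  change ∏ i, fourier (n i) ((y i : ℝ) : AddCircle (1 : ℝ)) = _
  simp only [fourier_coe_apply, ← Complex.exp_sum, waveForm]
  congr 1
  simp only [_root_.sum_apply, smul_apply, PiLp.proj_apply, smul_eq_mul,
    Complex.ofReal_sum, Finset.sum_mul]
  refine Finset.sum_congr rfl fun i _ => ?_
  push_cast
  ring

lemma denseRange_ellipticOp {a : Matrix (Fin d) (Fin d) ℝ} (ha : a.PosDef) {δ : ℝ}
    (hδ : 0 < δ) : DenseRange (ellipticOp a δ) := by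
  set R := (LinearMap.range (ellipticOp a δ)).topologicalClosure with hR
  let re : C(Torus d, ℂ) → C(Torus d, ℝ) := fun f =>
    (⟨Complex.re, Complex.continuous_re⟩ : C(ℂ, ℝ)).comp f
  let im : C(Torus d, ℂ) → C(Torus d, ℝ) := fun f =>
    (⟨Complex.im, Complex.continuous_im⟩ : C(ℂ, ℝ)).comp f
  have hre : Continuous re := ContinuousMap.continuous_postcomp _
  have him : Continuous im := ContinuousMap.continuous_postcomp _
  let S : Submodule ℂ C(Torus d, ℂ) :=
    { carrier := {f | re f ∈ R ∧ im f ∈ R}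
      add_mem' := fun {f g} hf hg => by
        refine ⟨?_, ?_⟩
        · have : re (f + g) = re f + re g := by ext; simp [re]
          rw [this]; exact R.add_mem hf.1 hg.1
        · have : im (f + g) = im f + im g := by ext; simp [im]
          rw [this]; exact R.add_mem hf.2 hg.2
      zero_mem' := by
        refine ⟨?_, ?_⟩
        · have : re 0 = 0 := by ext; simp [re]
          rw [this]; exact R.zero_mem
        · have : im 0 = 0 := by ext; simp [im]
          rw [this]; exact R.zero_mem
      smul_mem' := fun c f hf => by
        refine ⟨?_, ?_⟩
        · have : re (c • f) = c.re • re f - c.im • im f := by ext; simp [re, im]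
          rw [this]; exact R.sub_mem (R.smul_mem _ hf.1) (R.smul_mem _ hf.2)
        · have : im (c • f) = c.re • im f + c.im • re f := by ext; simp [re, im]
          rw [this]; exact R.add_mem (R.smul_mem _ hf.2) (R.smul_mem _ hf.1) }
  have hRc : IsClosed (R : Set C(Torus d, ℝ)) := Submodule.isClosed_topologicalClosure _
  have hSc : IsClosed (S : Set C(Torus d, ℂ)) := (hRc.preimage hre).inter (hRc.preimage him)
  have hle : Submodule.span ℂ (Set.range (UnitAddTorus.mFourier (d := Fin d))) ≤ S := by
    rw [Submodule.span_le]
    rintro _ ⟨n, rfl⟩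
    refine ⟨Submodule.le_topologicalClosure _ (mem_range_ellipticOp_of_wave ha hδ Real.contDiff_cos
        (φ' := fun s => -Real.sin s) Real.hasDerivAt_cos
        (fun s => (Real.hasDerivAt_sin s).neg) (waveForm n) _ ?_),
      Submodule.le_topologicalClosure _ (mem_range_ellipticOp_of_wave ha hδ Real.contDiff_sin
        Real.hasDerivAt_sin Real.hasDerivAt_cos (waveForm n) _ ?_)⟩
    · funext y
      change (UnitAddTorus.mFourier n (Torus.proj y)).re = _
      rw [mFourier_proj, Complex.exp_ofReal_mul_I_re]
    · funext y
      change (UnitAddTorus.mFourier n (Torus.proj y)).im = _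
      rw [mFourier_proj, Complex.exp_ofReal_mul_I_im]
  have htop : S = ⊤ := by
    refine top_le_iff.1 ?_
    rw [← UnitAddTorus.span_mFourier_closure_eq_top]
    exact Submodule.topologicalClosure_minimal _ hle hSc
  intro f
  have hf : (⟨Complex.ofReal, Complex.continuous_ofReal⟩ : C(ℝ, ℂ)).comp f ∈ S :=
    htop ▸ Submodule.mem_top
  exact hf.1

lemma gradient_estimate_ellipticOp {a : Matrix (Fin d) (Fin d) ℝ} (ha : a.PosDef) {δ M : ℝ}
    (hδ : 0 < δ) (hM : 0 ≤ M) : ∃ C, 0 ≤ C ∧ ∀ (w : C2Torus d) (g : ℝ), 0 ≤ g →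
      (∀ t, |ellipticOp a δ w t| ≤ M * ‖gradientOp w t‖ + g) →
      ‖w.1‖ ≤ C * g ∧ ‖gradientOp w‖ ≤ C * g := by
  obtain ⟨C, hC, h⟩ := gradient_estimate ha hδ hM
  refine ⟨C, hC, fun w g hg hw => ?_⟩
  obtain ⟨h1, h2⟩ := h w.1 (C2Torus.contDiff w) g hg fun y => by
    simpa only [ellipticOp_proj, gradientOp_proj, norm_gradient_eq] using hw (Torus.proj y)
  refine ⟨Torus.norm_le (by positivity) fun y => h1 _, Torus.norm_le (by positivity) fun y => ?_⟩
  rw [gradientOp_proj, norm_gradient_eq]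
  exact h2 y

lemma exists_resolvent {a : Matrix (Fin d) (Fin d) ℝ} (ha : a.PosDef) {δ : ℝ} (hδ : 0 < δ) :
    ∃ (S : C(Torus d, ℝ) →L[ℝ] C(Torus d, ℝ)) (G : C(Torus d, ℝ) →L[ℝ] C(Torus d, Euc d)),
      ∀ w : C2Torus d, S (ellipticOp a δ w) = w.1 ∧ G (ellipticOp a δ w) = gradientOp w := by
  obtain ⟨C, hC, h⟩ := gradient_estimate_ellipticOp ha hδ le_rfl
  have hb : ∀ w : C2Torus d, ‖w.1‖ ≤ C * ‖ellipticOp a δ w‖ ∧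
      ‖gradientOp w‖ ≤ C * ‖ellipticOp a δ w‖ := fun w => h w _ (norm_nonneg _) fun t => by
    rw [zero_mul, zero_add]
    exact (ellipticOp a δ w).norm_coe_le_norm t
  have hd := denseRange_ellipticOp ha hδ
  exact ⟨(C2Torus d).subtype.extendOfNorm (ellipticOp a δ), gradientOp.extendOfNorm (ellipticOp a δ),
    fun w => ⟨LinearMap.extendOfNorm_eq hd ⟨C, fun w => (hb w).1⟩ w,
      LinearMap.extendOfNorm_eq hd ⟨C, fun w => (hb w).2⟩ w⟩⟩

end Resolvent

section ImplicitFunction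

/-- A continuous branch of zeros along which the partial derivative is invertible is as smooth as
the equation. -/
lemma ContDiff.of_implicit {P Y : Type*} [NormedAddCommGroup P] [NormedSpace ℝ P] [CompleteSpace P]
    [NormedAddCommGroup Y] [NormedSpace ℝ Y] [CompleteSpace Y] {F : P × Y → Y}
    (hF : ContDiff ℝ 2 F) {g : P → Y} (hg : Continuous g) (h0 : ∀ z, F (z, g z) = 0)
    (hinv : ∀ z, IsUnit (fderiv ℝ F (z, g z) ∘L .inr ℝ P Y)) : ContDiff ℝ 2 g := by
  rw [contDiff_iff_contDiffAt]
  intro z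
  have cdf : ContDiffAt ℝ 2 F (z, g z) := hF.contDiffAt
  have if₂ : (fderiv ℝ F (z, g z) ∘L .inr ℝ P Y).IsInvertible := by
    obtain ⟨u, hu⟩ := hinv z
    exact ⟨ContinuousLinearEquiv.unitsEquiv ℝ Y u, hu⟩
  have pn : (2 : WithTop ℕ∞) ≠ 0 := two_ne_zero
  have hev := cdf.eventually_apply_eq_iff_implicitFunction pn if₂
  have ht : Tendsto (fun z' => (z', g z')) (𝓝 z) (𝓝 (z, g z)) :=
    (continuous_id.prodMk hg).tendsto z
  refine (cdf.contDiffAt_implicitFunction pn if₂).congr_of_eventuallyEq ?_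
  filter_upwards [ht.eventually hev] with z' hz'
  exact (hz'.1 (by rw [h0, h0])).symm

end ImplicitFunction

section ParametrizedNemytskii

variable {K : Type*} [TopologicalSpace K] [CompactSpace K] {P E : Type*}
  [NormedAddCommGroup P] [NormedSpace ℝ P] [NormedAddCommGroup E] [NormedSpace ℝ E]

lemma isBoundedLinearMap_const_prodMk :
    IsBoundedLinearMap ℝ fun s : P × C(K, E) => (ContinuousMap.const K s.1).prodMk s.2 := by
  refine IsLinearMap.with_bound ⟨fun s t => rfl, fun r s => rfl⟩ 1 fun s => ?_
  refine (ContinuousMap.norm_le _ (by positivity)).2 fun y => ?_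
  rw [one_mul]
  exact max_le_max le_rfl (s.2.norm_coe_le_norm y)

lemma contDiff_two_add_nemytskii {f : K → P × E → ℝ} {f' : K → P × E → P × E →L[ℝ] ℝ}
    {f'' : K → P × E → P × E →L[ℝ] P × E →L[ℝ] ℝ}
    (hf : Continuous (Function.uncurry f)) (hf' : Continuous (Function.uncurry f'))
    (hf'' : Continuous (Function.uncurry f''))
    (hd : ∀ y e, HasFDerivAt (f y) (f' y e) e) (hd' : ∀ y e, HasFDerivAt (f' y) (f'' y e) e)
    (G : C(K, ℝ) →L[ℝ] C(K, E)) :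
    ContDiff ℝ 2 fun s : P × C(K, ℝ) =>
      s.2 + nemytskii f hf ((ContinuousMap.const K s.1).prodMk (G s.2)) := by
  have h1 : ContDiff ℝ 2 fun s : P × C(K, ℝ) => (s.1, G s.2) :=
    contDiff_fst.prodMk (G.contDiff.comp contDiff_snd)
  have h2 : ContDiff ℝ 2 fun s : P × C(K, E) => (ContinuousMap.const K s.1).prodMk s.2 :=
    isBoundedLinearMap_const_prodMk.contDiff
  exact contDiff_snd.add ((contDiff_two_nemytskii hf hf' hf'' hd hd').comp (h2.comp h1))

lemma hasFDerivAt_add_nemytskii {f : K → P × E → ℝ} {f' : K → P × E → P × E →L[ℝ] ℝ}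
    (hf : Continuous (Function.uncurry f)) (hf' : Continuous (Function.uncurry f'))
    (hd : ∀ y e, HasFDerivAt (f y) (f' y e) e) (G : C(K, ℝ) →L[ℝ] C(K, E)) (z : P) (g : C(K, ℝ)) :
    ∃ b : C(K, E →L[ℝ] ℝ), HasFDerivAt (fun g : C(K, ℝ) =>
      g + nemytskii f hf ((ContinuousMap.const K z).prodMk (G g)))
      (1 + (pointwiseCLM b).comp G) g := by
  have hc : Continuous fun s : K × E => (s.1, (z, s.2)) := by fun_prop
  have hfz : Continuous (Function.uncurry fun y q => f y (z, q)) := hf.comp hc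
  have hfz' : Continuous (Function.uncurry fun y q => (f' y (z, q)).comp (.inr ℝ P E)) :=
    (hf'.comp hc).clm_comp continuous_const
  have hdz : ∀ y q, HasFDerivAt (fun q => f y (z, q)) ((f' y (z, q)).comp (.inr ℝ P E)) q :=
    fun y q => (hd y (z, q)).comp q (hasFDerivAt_prodMk_right z q)
  exact ⟨nemytskii _ hfz' (G g), (hasFDerivAt_id g).add
    ((hasFDerivAt_nemytskii hfz hfz' hdz (G g)).comp g G.hasFDerivAt)⟩

end ParametrizedNemytskii

section Invertibility

variable {d : ℕ}

lemma isUnit_one_add_gradient {a : Matrix (Fin d) (Fin d) ℝ} (ha : a.PosDef) {δ : ℝ} (hδ : 0 < δ)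
    {G : C(Torus d, ℝ) →L[ℝ] C(Torus d, Euc d)}
    (hG : ∀ w : C2Torus d, G (ellipticOp a δ w) = gradientOp w)
    (b : C(Torus d, Euc d →L[ℝ] ℝ)) : IsUnit (1 + (pointwiseCLM b).comp G) := by
  obtain ⟨C, hC, h⟩ := gradient_estimate_ellipticOp ha hδ (norm_nonneg b)
  refine isUnit_one_add_of_lower_bound _ (C := ‖b‖ * C + 1) (by positivity) fun t ht x => ?_
  refine (denseRange_ellipticOp ha hδ).induction_on
    (p := fun x => ‖x‖ ≤ (‖b‖ * C + 1) * ‖x + t • ((pointwiseCLM b).comp G) x‖) x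
    (isClosed_le (by fun_prop) (by fun_prop)) fun w => ?_
  set r := ellipticOp a δ w + t • ((pointwiseCLM b).comp G) (ellipticOp a δ w) with hr
  have hpt : ∀ y, |ellipticOp a δ w y| ≤ ‖b‖ * ‖gradientOp w y‖ + ‖r‖ := by
    intro y
    have h1 : ellipticOp a δ w y = r y - t * b y (gradientOp w y) := by
      rw [hr, ContinuousLinearMap.comp_apply, hG, ContinuousMap.add_apply, ContinuousMap.smul_apply,
        pointwiseCLM_apply, smul_eq_mul, add_sub_cancel_right]
    have h2 : |t * b y (gradientOp w y)| ≤ ‖b‖ * ‖gradientOp w y‖ := by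
      rw [abs_mul, abs_of_nonneg ht.1]
      refine (mul_le_of_le_one_left (abs_nonneg _) ht.2).trans ?_
      exact ((b y).le_opNorm _).trans (by gcongr; exact b.norm_coe_le_norm y)
    have h3 : |r y| ≤ ‖r‖ := r.norm_coe_le_norm y
    rw [h1]
    exact (abs_sub _ _).trans (by linarith)
  have hgrad := (h w ‖r‖ (norm_nonneg _) hpt).2
  refine (ContinuousMap.norm_le _ (by positivity)).2 fun y => (hpt y).trans ?_
  have h4 : ‖gradientOp w y‖ ≤ C * ‖r‖ := ((gradientOp w).norm_coe_le_norm y).trans hgrad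
  nlinarith [norm_nonneg b, mul_le_mul_of_nonneg_left h4 (norm_nonneg b)]

end Invertibility

section Hamiltonian

variable {d : ℕ} {V F : Type*} [NormedAddCommGroup V] [NormedSpace ℝ V]
  [NormedAddCommGroup F] [NormedSpace ℝ F]

lemma continuous_uncurry_of_lift {V F : Type*} [TopologicalSpace V] [TopologicalSpace F]
    {f : Torus d → V → F}
    (h : Continuous fun s : Euc d × V => f (Torus.proj s.1) s.2) :
    Continuous (Function.uncurry f) :=
  (Torus.isOpenQuotientMap_proj.prodMap IsOpenQuotientMap.id).continuous_comp_iff.1 h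

lemma contDiff_lift_fderiv {f : Torus d → V → F} {n m : WithTop ℕ∞} (hnm : n + 1 ≤ m)
    (h : ContDiff ℝ m fun s : Euc d × V => f (Torus.proj s.1) s.2) :
    ContDiff ℝ n fun s : Euc d × V => fderiv ℝ (f (Torus.proj s.1)) s.2 :=
  ContDiff.fderiv (f := fun (s : Euc d × V) e => f (Torus.proj s.1) e)
    (h.comp ((contDiff_fst.comp contDiff_fst).prodMk contDiff_snd)) contDiff_snd hnm

lemma hasFDerivAt_of_contDiff_lift {f : Torus d → V → F} {n : WithTop ℕ∞} (hn : n ≠ 0)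
    (h : ContDiff ℝ n fun s : Euc d × V => f (Torus.proj s.1) s.2) (y : Torus d) (e : V) :
    HasFDerivAt (f y) (fderiv ℝ (f y) e) e := by
  obtain ⟨y, rfl⟩ := Torus.proj_surjective y
  have h1 : ContDiff ℝ n (f (Torus.proj y)) := h.comp (contDiff_const.prodMk contDiff_id)
  exact (h1.differentiable hn e).hasFDerivAt

/-- A supremum of affine functions with slopes bounded by `M` is `M`-Lipschitz. -/
lemma abs_sSup_sub_sSup_le {m : ℕ} {ι : Type*} {A : Set ι} {φ : ι → ℝ} {f : ι → Euc m}
    {M : ℝ} (hM : 0 ≤ M) (hf : ∀ α ∈ A, ‖f α‖ ≤ M)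
    (hbdd : ∀ q, BddAbove ((fun α => φ α - ⟪q, f α⟫) '' A)) (q q' : Euc m) :
    |sSup ((fun α => φ α - ⟪q, f α⟫) '' A) - sSup ((fun α => φ α - ⟪q', f α⟫) '' A)|
      ≤ M * ‖q - q'‖ := by
  rcases A.eq_empty_or_nonempty with rfl | hne
  · simp only [Set.image_empty, sub_self, abs_zero]
    positivity
  have key : ∀ q q', sSup ((fun α => φ α - ⟪q, f α⟫) '' A)
      ≤ sSup ((fun α => φ α - ⟪q', f α⟫) '' A) + M * ‖q - q'‖ := by
    intro q q'
    refine csSup_le (hne.image _) ?_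
    rintro _ ⟨α, hα, rfl⟩
    have h1 := le_csSup (hbdd q') (Set.mem_image_of_mem _ hα)
    have h2 : ⟪q' - q, f α⟫ ≤ ‖q' - q‖ * ‖f α‖ := real_inner_le_norm _ _
    have h3 : ‖q' - q‖ * ‖f α‖ ≤ M * ‖q - q'‖ := by
      rw [norm_sub_rev, mul_comm]
      gcongr
      exact hf α hα
    rw [inner_sub_left] at h2
    simp only at h1 ⊢
    linarith
  have h1 := key q q'
  have h2 := key q' q
  rw [norm_sub_rev] at h2
  exact abs_le.2 ⟨by linarith, by linarith⟩

end Hamiltonian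

section CellProblem

variable {d : ℕ} {P : Type*} [NormedAddCommGroup P] [NormedSpace ℝ P]

/-- Solutions of a parametrized semilinear cell problem depend in a `C²` way on the parameter. -/
lemma contDiff_of_cell_problem [CompleteSpace P] {a : Matrix (Fin d) (Fin d) ℝ} (ha : a.PosDef)
    {δ : ℝ} (hδ : 0 < δ) {f : Torus d → P × Euc d → ℝ}
    (hf : ContDiff ℝ 2 fun s : Euc d × P × Euc d => f (Torus.proj s.1) s.2) {M : ℝ} (hM : 0 ≤ M)
    (hlip : ∀ y z q q', |f y (z, q) - f y (z, q')| ≤ M * ‖q - q'‖) (v : P → C2Torus d)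
    (hv : ∀ z t, ellipticOp a δ (v z) t + f t (z, gradientOp (v z) t) = 0) :
    ContDiff ℝ 2 fun z => (v z).1 := by
  obtain ⟨S, G, hSG⟩ := exists_resolvent ha hδ
  have hG := fun w => (hSG w).2
  have hf1 := contDiff_lift_fderiv (n := 1) (by norm_num) hf
  have hf2 := contDiff_lift_fderiv (f := fun y => fderiv ℝ (f y)) (n := 0) (by norm_num) hf1
  have hc := continuous_uncurry_of_lift hf.continuous
  have hc1 := continuous_uncurry_of_lift (f := fun y => fderiv ℝ (f y)) hf1.continuous
  have hc2 := continuous_uncurry_of_lift (f := fun y => fderiv ℝ (fderiv ℝ (f y))) hf2.continuous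
  have hd := hasFDerivAt_of_contDiff_lift two_ne_zero hf
  have hd1 := hasFDerivAt_of_contDiff_lift (f := fun y => fderiv ℝ (f y)) one_ne_zero hf1
  let N : P → C(Torus d, Euc d) → C(Torus d, ℝ) := fun z U =>
    nemytskii f hc ((ContinuousMap.const _ z).prodMk U)
  have hF : ContDiff ℝ 2 fun s : P × C(Torus d, ℝ) => s.2 + N s.1 (G s.2) :=
    contDiff_two_add_nemytskii hc hc1 hc2 hd hd1 G
  have hzero : ∀ z, ellipticOp a δ (v z) + N z (G (ellipticOp a δ (v z))) = 0 := by
    intro z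
    ext t
    rw [hG]
    exact hv z t
  have hinv : ∀ z, IsUnit (fderiv ℝ (fun s : P × C(Torus d, ℝ) => s.2 + N s.1 (G s.2))
      (z, ellipticOp a δ (v z)) ∘L .inr ℝ P C(Torus d, ℝ)) := by
    intro z
    obtain ⟨b, hb⟩ := hasFDerivAt_add_nemytskii hc hc1 hd G z (ellipticOp a δ (v z))
    have h1 := ((hF.differentiable two_ne_zero
      (z, ellipticOp a δ (v z))).hasFDerivAt).comp (ellipticOp a δ (v z))
      (hasFDerivAt_prodMk_right z (ellipticOp a δ (v z)))
    rw [h1.unique hb]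
    exact isUnit_one_add_gradient ha hδ hG b
  have hcont : Continuous fun z => ellipticOp a δ (v z) := by
    obtain ⟨C, hC, hest⟩ := gradient_estimate_ellipticOp ha hδ hM
    have hNc : ∀ U, Continuous fun z => N z U := fun U =>
      (continuous_nemytskii f hc).comp ((isBoundedLinearMap_const_prodMk (K := Torus d)
        (P := P) (E := Euc d)).continuous.comp (continuous_id.prodMk continuous_const))
    rw [continuous_iff_continuousAt]
    intro z₀
    refine tendsto_iff_norm_sub_tendsto_zero.2 ?_
    have hlim : Tendsto (fun z => (M * C + 1) * ‖N z (gradientOp (v z₀)) - N z₀ (gradientOp (v z₀))‖)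
        (𝓝 z₀) (𝓝 0) := by
      simpa using (tendsto_iff_norm_sub_tendsto_zero.1
        ((hNc (gradientOp (v z₀))).tendsto z₀)).const_mul (M * C + 1)
    refine squeeze_zero (fun _ => norm_nonneg _) (fun z => ?_) hlim
    set r := N z (gradientOp (v z₀)) - N z₀ (gradientOp (v z₀)) with hr
    have hpt : ∀ t, |ellipticOp a δ (v z - v z₀) t| ≤ M * ‖gradientOp (v z - v z₀) t‖ + ‖r‖ := by
      intro t
      have h1 := hv z t
      have h2 := hv z₀ t
      have h3 := hlip t z (gradientOp (v z) t) (gradientOp (v z₀) t)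
      have h4 : |f t (z, gradientOp (v z₀) t) - f t (z₀, gradientOp (v z₀) t)| ≤ ‖r‖ :=
        r.norm_coe_le_norm t
      rw [map_sub, map_sub, ContinuousMap.sub_apply, ContinuousMap.sub_apply]
      rw [abs_le] at h3 h4 ⊢
      exact ⟨by linarith [h3.2, h4.2], by linarith [h3.1, h4.1]⟩
    have hgrad := (hest _ ‖r‖ (norm_nonneg _) hpt).2
    rw [← map_sub]
    refine (ContinuousMap.norm_le _ (by positivity)).2 fun t => (hpt t).trans ?_
    have h5 : ‖gradientOp (v z - v z₀) t‖ ≤ C * ‖r‖ :=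
      ((gradientOp (v z - v z₀)).norm_coe_le_norm t).trans hgrad
    nlinarith [mul_le_mul_of_nonneg_left h5 hM]
  have hg := ContDiff.of_implicit hF hcont hzero hinv
  have hS : (fun z => (v z).1) = fun z => S (ellipticOp a δ (v z)) :=
    funext fun z => ((hSG (v z)).1).symm
  rw [hS]
  exact S.contDiff.comp hg

lemma contDiff_eval_and_continuous_iteratedFDeriv [FiniteDimensional ℝ P]
    {Φ : P → C(Torus d, ℝ)} (hΦ : ContDiff ℝ 2 Φ) :
    (∀ y, ContDiff ℝ 2 fun z => Φ z y) ∧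
    Continuous fun t : P × Euc d => iteratedFDeriv ℝ 2 (fun z => Φ z (Torus.proj t.2)) t.1 := by
  have hev : ∀ y : Torus d, IsBoundedLinearMap ℝ fun g : C(Torus d, ℝ) => g y := fun y =>
    IsLinearMap.with_bound ⟨fun _ _ => rfl, fun _ _ => rfl⟩ 1 fun g => by
      rw [one_mul]; exact g.norm_coe_le_norm y
  refine ⟨fun y => (hev y).contDiff.comp hΦ, continuous_multilinear_of_forall_apply 2 _ fun m => ?_⟩
  have h1 : ∀ t : P × Euc d, iteratedFDeriv ℝ 2 (fun z => Φ z (Torus.proj t.2)) t.1 m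
      = iteratedFDeriv ℝ 2 Φ t.1 m (Torus.proj t.2) := by
    intro t
    have h := (hev (Torus.proj t.2)).toContinuousLinearMap.iteratedFDeriv_comp_left
      (hΦ.contDiffAt (x := t.1)) (i := 2) le_rfl
    exact congrArg (fun T => T m) h
  simp only [h1]
  have h2 : Continuous fun t : P × Euc d => iteratedFDeriv ℝ 2 Φ t.1 m :=
    ((ContinuousMultilinearMap.apply ℝ (fun _ : Fin 2 => P) C(Torus d, ℝ) m).continuous.comp
      (hΦ.continuous_iteratedFDeriv (m := 2) le_rfl)).comp continuous_fst
  exact (continuous_eval (F := C(Torus d, ℝ))).comp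
    (h2.prodMk (Torus.continuous_proj.comp continuous_snd))

end CellProblem

/-- Joint C² regularity in `(x,p)` of the solution `v^δ(x,p,·)` of the
discounted cell problem: the map `(x,p) ↦ v^δ(x,p,y)` is twice continuously differentiable, and
its second derivative is continuous as a function of `(x,p,y)`. -/
theorem discounted_solution_xp_C2 (d : ℕ)
    -- `a = σ₂σ₂ᵀ + σ_{0,2}σ_{0,2}ᵀ` is a constant symmetric positive definite matrix
    (a : Matrix (Fin d) (Fin d) ℝ) (ha : a.PosDef) (haS : a.IsSymm)
    -- `A ⊂ ℝ^{2d}` is a compact set of controls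
    (A : Set (Euc (2*d))) (hA : IsCompact A)
    -- the data `c, f, L`, continuous and Lipschitz in `(x,y,μ)` uniformly in `α ∈ A`
    (c f : Torus d → Torus d → Euc (2*d) → ProbT d → Euc d)
    (L : Torus d → Torus d → Euc (2*d) → ProbT d → ℝ)
    (hccont : ∀ μ, Continuous fun z : Torus d × Torus d × Euc (2*d) => c z.1 z.2.1 z.2.2 μ)
    (hfcont : ∀ μ, Continuous fun z : Torus d × Torus d × Euc (2*d) => f z.1 z.2.1 z.2.2 μ)
    (hLcont : ∀ μ, Continuous fun z : Torus d × Torus d × Euc (2*d) => L z.1 z.2.1 z.2.2 μ)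
    (K : ℝ)
    (hclip : ∀ x x' y y' α μ μ', α ∈ A →
      ‖c x y α μ - c x' y' α μ'‖ ≤ K * (dist x x' + dist y y' + W1T μ μ'))
    (hflip : ∀ x x' y y' α μ μ', α ∈ A →
      ‖f x y α μ - f x' y' α μ'‖ ≤ K * (dist x x' + dist y y' + W1T μ μ'))
    (hLlip : ∀ x x' y y' α μ μ', α ∈ A →
      |L x y α μ - L x' y' α μ'| ≤ K * (dist x x' + dist y y' + W1T μ μ'))
    -- the Bellman Hamiltonian
    (H : Torus d → Torus d → Euc d → Euc d → ProbT d → ℝ)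
    (hHdef : ∀ x y p q μ,
      H x y p q μ =
        sSup ((fun α => -⟪p, c x y α μ⟫ - ⟪q, f x y α μ⟫ - L x y α μ) '' A))
    (C_H β : ℝ) (hβ0 : 0 < β) (hβ1 : β < 1)
    (hHC2 : ∀ μ, ContDiff ℝ 2
      (fun z : Euc d × Euc d × Euc d × Euc d =>
        H (Torus.proj z.1) (Torus.proj z.2.1) z.2.2.1 z.2.2.2 μ))
    -- with second derivative locally β-Hölder continuous uniformly in `μ`
    (hHholder : ∀ R : ℝ, 0 < R → ∃ C : ℝ, ∀ μ, ∀ z z' : Euc d × Euc d × Euc d × Euc d,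
      ‖z‖ ≤ R → ‖z'‖ ≤ R →
      ‖iteratedFDeriv ℝ 2 (fun w : Euc d × Euc d × Euc d × Euc d =>
          H (Torus.proj w.1) (Torus.proj w.2.1) w.2.2.1 w.2.2.2 μ) z
        - iteratedFDeriv ℝ 2 (fun w : Euc d × Euc d × Euc d × Euc d =>
          H (Torus.proj w.1) (Torus.proj w.2.1) w.2.2.1 w.2.2.2 μ) z'‖
        ≤ C * ‖z - z'‖ ^ β)
    -- `|D_x H| ≤ C_H (1+|p|)` and `|D_p H| ≤ C_H (1+|p|)`
    (hDx : ∀ (x : Euc d) (y : Torus d) (p q : Euc d) (μ : ProbT d),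
      ‖fderiv ℝ (fun x' : Euc d => H (Torus.proj x') y p q μ) x‖ ≤ C_H * (1 + ‖p‖))
    (hDp : ∀ (x y : Torus d) (p q : Euc d) (μ : ProbT d),
      ‖fderiv ℝ (fun p' : Euc d => H x y p' q μ) p‖ ≤ C_H * (1 + ‖p‖))
    (δ : ℝ) (hδ : 0 < δ) (μ : ProbT d)
    (v : Torus d → Euc d → Torus d → ℝ)
    (hv : ∀ (x : Torus d) (p : Euc d), IsSol a H δ x p μ (v x p)) :
    (∀ y : Torus d, ContDiff ℝ 2 (fun z : Euc d × Euc d => v (Torus.proj z.1) z.2 y)) ∧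
    Continuous (fun t : (Euc d × Euc d) × Euc d =>
      iteratedFDeriv ℝ 2
        (fun z : Euc d × Euc d => v (Torus.proj z.1) z.2 (Torus.proj t.2)) t.1) := by
  obtain ⟨M, hM⟩ : ∃ M, ∀ x y, ∀ α ∈ A, ‖f x y α μ‖ ≤ M := by
    obtain ⟨M, hM⟩ := ((isCompact_univ (X := Torus d)).prod
      ((isCompact_univ (X := Torus d)).prod hA)).exists_bound_of_continuousOn
      (hfcont μ).continuousOn
    exact ⟨M, fun x y α hα => hM (x, y, α) ⟨Set.mem_univ _, Set.mem_univ _, hα⟩⟩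
  have hlip : ∀ x y p q q', |H x y p q μ - H x y p q' μ| ≤ max M 0 * ‖q - q'‖ := by
    intro x y p q q'
    have hsub : ∀ q, (fun α => -⟪p, c x y α μ⟫ - ⟪q, f x y α μ⟫ - L x y α μ)
        = fun α => (-⟪p, c x y α μ⟫ - L x y α μ) - ⟪q, f x y α μ⟫ :=
      fun q => funext fun α => by ring
    have hα : Continuous fun α : Euc (2 * d) => (x, y, α) := by fun_prop
    have hcc : Continuous fun α => c x y α μ := (hccont μ).comp hα
    have hfc : Continuous fun α => f x y α μ := (hfcont μ).comp hα
    have hLc : Continuous fun α => L x y α μ := (hLcont μ).comp hα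
    rw [hHdef, hHdef, hsub, hsub]
    refine abs_sSup_sub_sSup_le (le_max_right _ _)
      (fun α hα => (hM x y α hα).trans (le_max_left _ _)) (fun q => ?_) q q'
    exact hA.bddAbove_image (by fun_prop)
  have hf : ContDiff ℝ 2 fun s : Euc d × (Euc d × Euc d) × Euc d =>
      H (Torus.proj s.2.1.1) (Torus.proj s.1) s.2.1.2 s.2.2 μ :=
    (hHC2 μ).comp (g := fun z : Euc d × Euc d × Euc d × Euc d =>
        H (Torus.proj z.1) (Torus.proj z.2.1) z.2.2.1 z.2.2.2 μ)
      (f := fun s : Euc d × (Euc d × Euc d) × Euc d => (s.2.1.1, s.1, s.2.1.2, s.2.2))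
      (by fun_prop)
  let w : Euc d × Euc d → C2Torus d := fun z =>
    ⟨⟨v (Torus.proj z.1) z.2, continuous_of_tlift (hv _ _).1.continuous⟩, (hv _ _).1⟩
  have hw : ContDiff ℝ 2 fun z => (w z).1 := by
    refine contDiff_of_cell_problem ha hδ
      (f := fun y e => H (Torus.proj e.1.1) y e.1.2 e.2 μ) hf (le_max_right M 0)
      (fun y z q q' => hlip _ _ _ _ _) w fun z t => ?_
    obtain ⟨y, rfl⟩ := Torus.proj_surjective t
    rw [ellipticOp_proj, gradientOp_proj]
    exact (hv (Torus.proj z.1) z.2).2 y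
  exact contDiff_eval_and_continuous_iteratedFDeriv hw
end
end
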